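/- Let k be an algebraically closed field with char(k) ≠ 2. For finite subsets I, J of k∖{2,−2}, the subgroups G_I and G_J of Aut_k(k(x,y)) are conjugate in Aut_k(k(x,y)) if and only if there exists γ ∈ 𝔖₃ (a homography of ℙ¹(k) preserving {2,−2,∞}) such that J = γ(I). In other words, the map I ↦ G_I induces a bijection between finite subsets of k∖{2,−2} modulo the action of 𝔖₃ and conjugacy classes of the subgroups G_I in the Cremona group Aut_k(k(x,y)). -/

import Mathlib

open scoped OnePoint Classical

/-- The field `k(x,y)` of rational functions in two variables over `k`. -/
noncomputable abbrev Kxy (k : Type*) [Field k] : Type _ :=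
  FractionRing (MvPolynomial (Fin 2) k)

/-- The images of the variables `x = X 0` and `y = X 1` in `k(x,y)`. -/
noncomputable abbrev Xv (k : Type*) [Field k] (i : Fin 2) : Kxy k :=
  algebraMap (MvPolynomial (Fin 2) k) (Kxy k) (MvPolynomial.X i)

/-- The homography `z ↦ (az+b)/(cz+d)` of `ℙ¹(k) = k ∪ {∞}`. -/
noncomputable def moebius (k : Type*) [Field k] (a b c d : k) :
    OnePoint k → OnePoint k := fun z =>
  Option.elim z (if c = 0 then ∞ else ((a / c : k) : OnePoint k))
    (fun w => if c * w + d = 0 then ∞ else (((a * w + b) / (c * w + d) : k) : OnePoint k))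

/-- For a finite set `I ⊆ k ∖ {2,-2}`, the subgroup `G_I` of `Aut_k(k(x,y))` generated by
the involutions `x ↦ -x`, `x ↦ 1/x`, `y ↦ -y` and `y ↦ P(x)/y`,
where `P(x) = ∏_{a ∈ I} (x² + x⁻² - a)`. -/
noncomputable def GI (k : Type*) [Field k] (I : Finset k) :
    Subgroup (Kxy k ≃ₐ[k] Kxy k) :=
  Subgroup.closure {σ : Kxy k ≃ₐ[k] Kxy k |
    (σ (Xv k 0) = -Xv k 0 ∧ σ (Xv k 1) = Xv k 1) ∨
    (σ (Xv k 0) = (Xv k 0)⁻¹ ∧ σ (Xv k 1) = Xv k 1) ∨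
    (σ (Xv k 0) = Xv k 0 ∧ σ (Xv k 1) = -Xv k 1) ∨
    (σ (Xv k 0) = Xv k 0 ∧
      σ (Xv k 1) =
        (∏ a ∈ I, (Xv k 0 ^ 2 + (Xv k 0 ^ 2)⁻¹ - algebraMap k (Kxy k) a)) * (Xv k 1)⁻¹)}

/-- The element `∏_{a ∈ I} (x² + x⁻² - a)` of a field extension of `k`. -/
noncomputable def fibreProd {k K : Type*} [Field k] [Field K] [Algebra k K] (I : Finset k)
    (x : K) : K :=
  ∏ a ∈ I, (x ^ 2 + (x ^ 2)⁻¹ - algebraMap k K a)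

section Descent

open Polynomial

lemma injective_vec_four {α : Type*} {a b c d : α} (hab : a ≠ b) (hac : a ≠ c) (had : a ≠ d)
    (hbc : b ≠ c) (hbd : b ≠ d) (hcd : c ≠ d) : Function.Injective ![a, b, c, d] := by
  have h : List.Nodup [a, b, c, d] := by simp [hab, hac, had, hbc, hbd, hcd]
  exact List.nodup_ofFn.1 (by simpa [List.ofFn_succ] using h)

variable {k : Type*} [Field k] [IsAlgClosed k]

lemma exists_sq_of_isCoprime_mul_eq_sq {p q z : k[X]} (h : IsCoprime p q)
    (e : p * q = z ^ 2) : ∃ d, p = d ^ 2 := by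
  obtain ⟨d, u, hu⟩ := exists_associated_pow_of_mul_eq_pow' h e
  obtain ⟨c, -, hc⟩ := Polynomial.isUnit_iff.1 u.isUnit
  obtain ⟨e, he⟩ := IsAlgClosed.exists_pow_nat_eq c (n := 2) (by norm_num)
  exact ⟨d * C e, by rw [← hu, ← hc, ← he, mul_pow, C_pow]⟩

lemma exists_sq_C_mul {p : k[X]} (c : k) (h : ∃ d, p = d ^ 2) : ∃ d, C c * p = d ^ 2 := by
  obtain ⟨d, rfl⟩ := h
  obtain ⟨e, he⟩ := IsAlgClosed.exists_pow_nat_eq c (n := 2) (by norm_num)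
  exact ⟨C e * d, by rw [← he, mul_pow, C_pow]⟩

omit [IsAlgClosed k] in
lemma isCoprime_sub_C_mul {p q : k[X]} (h : IsCoprime p q) {a b : k} (hab : a ≠ b) :
    IsCoprime (p - C a * q) (p - C b * q) := by
  obtain ⟨u, v, huv⟩ := h
  have hc : C (b - a) * C (b - a)⁻¹ = (1 : k[X]) := by
    rw [← C_mul, mul_inv_cancel₀ (sub_ne_zero.2 hab.symm), C_1]
  refine ⟨C (b - a)⁻¹ * (u * C b + v), C (b - a)⁻¹ * (-u * C a - v), ?_⟩
  simp only [C_sub] at hc ⊢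
  linear_combination huv + (u * p + v * q) * hc

/-- Two coprime polynomials with four distinct members of their pencil being squares are
constant. -/
lemma natDegree_eq_zero_of_four_squares (h2 : (2 : k) ≠ 0) (n : ℕ) :
    ∀ (p q : k[X]) (a : Fin 4 → k), IsCoprime p q → Function.Injective a →
      (∀ i, ∃ d, p - C (a i) * q = d ^ 2) → max p.natDegree q.natDegree ≤ n →
      p.natDegree = 0 ∧ q.natDegree = 0 := by
  induction n using Nat.strong_induction_on with
  | _ n ih =>
  intro p q a hpq ha hsq hn
  have hne : ∀ i j, i ≠ j → a i - a j ≠ 0 := fun i j hij => sub_ne_zero.2 fun h => hij (ha h)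
  have h10 := hne 1 0 (by decide)
  have h12 := hne 1 2 (by decide)
  have h13 := hne 1 3 (by decide)
  have h02 := hne 0 2 (by decide)
  have h03 := hne 0 3 (by decide)
  have h23 := hne 2 3 (by decide)
  obtain ⟨f, hf⟩ := hsq 0
  obtain ⟨g, hg⟩ := exists_sq_C_mul ((a 0 - a 2) / (a 1 - a 2)) (hsq 1)
  obtain ⟨m, hm⟩ := IsAlgClosed.exists_pow_nat_eq
    ((a 0 - a 3) * (a 1 - a 2) / ((a 1 - a 3) * (a 0 - a 2))) (n := 2) (by norm_num)
  have hm0 : m ≠ 0 := by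
    rintro rfl
    have : (a 0 - a 3) * (a 1 - a 2) / ((a 1 - a 3) * (a 0 - a 2)) ≠ 0 := by positivity
    exact this (by rw [← hm]; ring)
  have hm1 : m ^ 2 ≠ 1 := by
    rw [hm]
    intro h
    rw [div_eq_one_iff_eq (by positivity)] at h
    have : (a 1 - a 0) * (a 2 - a 3) = 0 := by linear_combination h
    exact mul_ne_zero h10 h23 this
  have hcop : IsCoprime f g := by
    have h1 : IsCoprime (p - C (a 0) * q) (C ((a 0 - a 2) / (a 1 - a 2)) * (p - C (a 1) * q)) := by
      exact (isCoprime_mul_unit_left_right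
        (isUnit_C.2 (isUnit_iff_ne_zero.2 (div_ne_zero h02 h12))) _ _).2
        (isCoprime_sub_C_mul hpq (sub_ne_zero.1 h10).symm)
    rw [hf, hg] at h1
    exact (IsCoprime.pow_iff (by norm_num) (by norm_num)).1 h1
  rcases Nat.eq_zero_or_pos n with rfl | hnpos
  · simpa using hn
  have hb : Function.Injective ![1, -1, m, -m] := by
    have e1 : m ≠ 1 := by rintro rfl; simp at hm1
    have e2 : m ≠ -1 := by rintro rfl; simp at hm1
    have e3 : (1 : k) ≠ -1 := fun h => h2 (by linear_combination h)
    have e4 : m ≠ -m := fun h => mul_ne_zero h2 hm0 (by linear_combination h)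
    have e5 : -m ≠ 1 := fun h => e2 (by linear_combination -h)
    have e6 : -m ≠ -1 := fun h => e1 (by linear_combination -h)
    exact injective_vec_four e3 e1.symm e5.symm e2.symm e6.symm e4
  have c12 : C (a 1 - a 2) * C (a 1 - a 2)⁻¹ = (1 : k[X]) := by
    rw [← C_mul, mul_inv_cancel₀ h12, C_1]
  have c13 : C (a 1 - a 3) * C (a 1 - a 3)⁻¹ = (1 : k[X]) := by
    rw [← C_mul, mul_inv_cancel₀ h13, C_1]
  have hg' : C ((a 0 - a 3) / (a 1 - a 3)) * (p - C (a 1) * q) = C m ^ 2 * g ^ 2 := by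
    rw [← hg, ← C_pow, hm, ← mul_assoc, ← C_mul]
    congr 2
    field_simp
  obtain ⟨d₂, hd₂⟩ := exists_sq_C_mul ((a 1 - a 0) / (a 1 - a 2)) (hsq 2)
  obtain ⟨d₃, hd₃⟩ := exists_sq_C_mul ((a 1 - a 0) / (a 1 - a 3)) (hsq 3)
  have e2 : (f - C 1 * g) * (f - C (-1) * g) = d₂ ^ 2 := by
    rw [← hd₂]
    simp only [div_eq_mul_inv, C_mul, C_sub, C_neg, C_1] at *
    linear_combination hg - hf - (p - C (a 0) * q) * c12
  have e3 : (f - C m * g) * (f - C (-m) * g) = d₃ ^ 2 := by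
    rw [← hd₃]
    simp only [div_eq_mul_inv, C_mul, C_sub, C_neg, C_1] at *
    linear_combination hg' - hf - (p - C (a 0) * q) * c13
  have hsq' : ∀ i, ∃ d, f - C (![1, -1, m, -m] i) * g = d ^ 2 := by
    have i01 := isCoprime_sub_C_mul hcop (hb.ne (show (0 : Fin 4) ≠ 1 by decide))
    have i23 := isCoprime_sub_C_mul hcop (hb.ne (show (2 : Fin 4) ≠ 3 by decide))
    intro i
    fin_cases i
    · exact exists_sq_of_isCoprime_mul_eq_sq i01 e2
    · exact exists_sq_of_isCoprime_mul_eq_sq i01.symm ((mul_comm _ _).trans e2)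
    · exact exists_sq_of_isCoprime_mul_eq_sq i23 e3
    · exact exists_sq_of_isCoprime_mul_eq_sq i23.symm ((mul_comm _ _).trans e3)
  have hdeg : ∀ c : k, (p - C c * q).natDegree ≤ n := fun c =>
    (natDegree_sub_le _ _).trans (max_le ((le_max_left _ _).trans hn)
      ((natDegree_C_mul_le _ _).trans ((le_max_right _ _).trans hn)))
  have hfd : 2 * f.natDegree ≤ n := by
    rw [← natDegree_pow, ← hf]; exact hdeg _
  have hgd : 2 * g.natDegree ≤ n := by
    rw [← natDegree_pow, ← hg]; exact (natDegree_C_mul_le _ _).trans (hdeg _)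
  obtain ⟨hf0, hg0⟩ := ih (n / 2) (by omega) f g _ hcop hb hsq' (max_le (by omega) (by omega))
  have hp0 : (p - C (a 0) * q).natDegree = 0 := by rw [hf, natDegree_pow, hf0]
  have hq0 : (p - C (a 1) * q).natDegree = 0 := by
    rw [← natDegree_C_mul (div_ne_zero h02 h12), hg, natDegree_pow, hg0]
  have c10 : C (a 1 - a 0) * C (a 1 - a 0)⁻¹ = (1 : k[X]) := by
    rw [← C_mul, mul_inv_cancel₀ h10, C_1]
  obtain ⟨r, hr⟩ := natDegree_eq_zero.1 hp0
  obtain ⟨s, hs⟩ := natDegree_eq_zero.1 hq0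
  have hq : q = C ((a 1 - a 0)⁻¹ * (r - s)) := by
    simp only [C_mul, C_sub] at *
    linear_combination (-q) * c10 - C (a 1 - a 0)⁻¹ * (hr - hs)
  have hp : p = C (r + a 0 * ((a 1 - a 0)⁻¹ * (r - s))) := by
    rw [C_add, C_mul, ← hq, hr]; ring
  rw [hq, hp]
  exact ⟨natDegree_C _, natDegree_C _⟩

lemma ratFunc_eq_C_of_sq_eq_fibreProd (h2 : (2 : k) ≠ 0) {I : Finset k}
    (hI : ∀ a ∈ I, a ≠ 2 ∧ a ≠ -2) (hne : I.Nonempty) {u w : RatFunc k}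
    (h : w ^ 2 = fibreProd I u) : ∃ c, u = RatFunc.C c := by
  by_cases hu0 : u = 0
  · exact ⟨0, by simp [hu0]⟩
  set p := u.num with hp
  set q := u.denom with hq
  have hpq : IsCoprime p q := RatFunc.isCoprime_num_denom u
  have hq0 : q ≠ 0 := RatFunc.denom_ne_zero u
  have hp0 : p ≠ 0 := by rwa [hp, Ne, RatFunc.num_eq_zero_iff]
  have hu : u = algebraMap k[X] (RatFunc k) p / algebraMap k[X] (RatFunc k) q :=
    (RatFunc.num_div_denom u).symm
  have hP : algebraMap k[X] (RatFunc k) p ≠ 0 := by simpa using hp0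
  have hQ : algebraMap k[X] (RatFunc k) q ≠ 0 := by simpa using hq0
  let F : k → k[X] := fun a => p ^ 4 + q ^ 4 - C a * p ^ 2 * q ^ 2
  have hF : ∀ a, (u ^ 2 + (u ^ 2)⁻¹ - algebraMap k (RatFunc k) a) *
      (algebraMap k[X] (RatFunc k) (p * q)) ^ 2 = algebraMap k[X] (RatFunc k) (F a) := by
    intro a
    have : algebraMap k (RatFunc k) a = algebraMap k[X] (RatFunc k) (C a) := by
      rw [IsScalarTower.algebraMap_apply k k[X] (RatFunc k)]; rfl
    rw [this, hu]
    simp only [F, map_sub, map_add, map_mul, map_pow]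
    field_simp
  have hprod : (w * algebraMap k[X] (RatFunc k) (p * q) ^ I.card) ^ 2 =
      algebraMap k[X] (RatFunc k) (∏ a ∈ I, F a) := by
    rw [mul_pow, h, fibreProd, map_prod, ← Finset.prod_congr rfl fun a _ => hF a,
      Finset.prod_mul_distrib, Finset.prod_const, ← pow_mul, ← pow_mul, mul_comm I.card]
  obtain ⟨z, hz⟩ := IsIntegrallyClosed.exists_algebraMap_eq_of_isIntegral_pow
    (R := k[X]) (x := w * algebraMap k[X] (RatFunc k) (p * q) ^ I.card) (n := 2) (by norm_num)
    (hprod ▸ isIntegral_algebraMap)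
  rw [← hz, ← map_pow] at hprod
  have hprod := (RatFunc.algebraMap_injective k) hprod
  obtain ⟨a, ha⟩ := hne
  rw [← Finset.mul_prod_erase _ _ ha] at hprod
  have hcop : IsCoprime (F a) (∏ b ∈ I.erase a, F b) := by
    refine IsCoprime.prod_right fun b hb => ?_
    have hab : a - b ≠ 0 := sub_ne_zero.2 (Finset.ne_of_mem_erase hb).symm
    have hu' : IsUnit (C (a - b) : k[X]) := isUnit_C.2 hab.isUnit
    have e1 : IsCoprime (F a) (p ^ 2 * q ^ 2) := by
      refine IsCoprime.mul_right ?_ ?_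
      · have : IsCoprime (p ^ 2) (q ^ 4) := hpq.pow
        have h4 := this.symm.add_mul_left_left (p ^ 2 - C a * q ^ 2)
        rwa [show q ^ 4 + p ^ 2 * (p ^ 2 - C a * q ^ 2) = F a by simp only [F]; ring] at h4
      · have : IsCoprime (p ^ 4) (q ^ 2) := hpq.pow
        have h4 := this.add_mul_left_left (q ^ 2 - C a * p ^ 2)
        rwa [show p ^ 4 + q ^ 2 * (q ^ 2 - C a * p ^ 2) = F a by simp only [F]; ring] at h4
    have e2 := ((isCoprime_mul_unit_left_right hu' _ _).2 e1).add_mul_left_right 1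
    rwa [show C (a - b) * (p ^ 2 * q ^ 2) + F a * 1 = F b by simp only [F, C_sub]; ring] at e2
  obtain ⟨d, hd⟩ := exists_sq_of_isCoprime_mul_eq_sq hcop hprod.symm
  obtain ⟨s, hs⟩ := IsAlgClosed.exists_pow_nat_eq (a ^ 2 - 4) (n := 2) (by norm_num)
  obtain ⟨b, hb⟩ := IsAlgClosed.exists_pow_nat_eq ((a + s) / 2) (n := 2) (by norm_num)
  have hb4 : b ^ 4 - a * b ^ 2 + 1 = 0 := by
    rw [show b ^ 4 = (b ^ 2) ^ 2 by ring, hb]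
    field_simp
    linear_combination hs
  have hb0 : b ≠ 0 := by rintro rfl; simp at hb4
  have hbb : b ^ 4 ≠ 1 := by
    intro hb1
    have : (b ^ 2 - 1) * (b ^ 2 + 1) = 0 := by linear_combination hb1
    rcases mul_eq_zero.1 this with h | h
    · exact (hI a ha).1 (by linear_combination -hb4 + (b ^ 2 + 1 - a) * h)
    · exact (hI a ha).2 (by linear_combination hb4 - (b ^ 2 - 1 - a) * h)
  have hinj : Function.Injective ![b, -b, b⁻¹, -b⁻¹] := by
    have e1 : b ≠ -b := fun h => mul_ne_zero h2 hb0 (by linear_combination h)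
    have e2 : b⁻¹ ≠ -b⁻¹ := fun h => mul_ne_zero h2 (inv_ne_zero hb0) (by linear_combination h)
    have e3 : b ≠ b⁻¹ := fun h => hbb (by
      have : b * b = 1 := by nth_rw 2 [h]; exact mul_inv_cancel₀ hb0
      linear_combination (b * b + 1) * this)
    have e4 : b ≠ -b⁻¹ := fun h => hbb (by
      have : b * b = -1 := by nth_rw 2 [h]; rw [mul_neg, mul_inv_cancel₀ hb0]
      linear_combination (b * b - 1) * this)
    have e5 : -b ≠ b⁻¹ := fun h => e4 (by linear_combination -h)
    have e6 : -b ≠ -b⁻¹ := fun h => e3 (by linear_combination -h)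
    exact injective_vec_four e1 e3 e4 e5 e6 e2
  have hbC : C b * C b⁻¹ = (1 : k[X]) := by rw [← C_mul, mul_inv_cancel₀ hb0, C_1]
  have hsum : C b ^ 2 + C b⁻¹ ^ 2 = (C a : k[X]) := by
    rw [← C_pow, ← C_pow, ← C_add]
    congr 1
    field_simp
    linear_combination hb4
  have hfac : ∏ i, (p - C (![b, -b, b⁻¹, -b⁻¹] i) * q) = d ^ 2 := by
    rw [← hd, Fin.prod_univ_four]
    simp only [F, Matrix.cons_val, C_neg]
    linear_combination -p ^ 2 * q ^ 2 * hsum + q ^ 4 * (C b * C b⁻¹ + 1) * hbC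
  obtain ⟨h1, h2'⟩ := natDegree_eq_zero_of_four_squares h2 _ p q _ hpq hinj (fun i => by
    rw [← Finset.mul_prod_erase _ _ (Finset.mem_univ i)] at hfac
    refine exists_sq_of_isCoprime_mul_eq_sq (IsCoprime.prod_right fun j hj => ?_) hfac
    exact isCoprime_sub_C_mul hpq (hinj.ne (Finset.ne_of_mem_erase hj).symm)) le_rfl
  exact (RatFunc.eq_C_iff u).2 ⟨h1, h2'⟩

end Descent

section Coordinates

open IntermediateField

variable {k K : Type*} [Field k] [Field K] [Algebra k K]

/-- A pair of algebraically independent generators of the field extension `K / k`. -/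
structure IsCoord (k : Type*) {K : Type*} [Field k] [Field K] [Algebra k K] (x y : K) : Prop where
  algebraicIndependent : AlgebraicIndependent k ![x, y]
  adjoin_eq_top : adjoin k {x, y} = ⊤

lemma isCoord_Xv (k : Type*) [Field k] : IsCoord k (Xv k 0) (Xv k 1) := by
  have hrange : ![Xv k 0, Xv k 1] =
      fun i => algebraMap (MvPolynomial (Fin 2) k) (Kxy k) (MvPolynomial.X i) := by
    funext i
    fin_cases i <;> rfl
  constructor
  · rw [hrange]
    exact (MvPolynomial.algebraicIndependent_X (Fin 2) k).map'
      (f := IsScalarTower.toAlgHom k (MvPolynomial (Fin 2) k) (Kxy k))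
      (IsFractionRing.injective (MvPolynomial (Fin 2) k) (Kxy k))
  · rw [eq_top_iff]
    intro z _
    obtain ⟨p, q, _, rfl⟩ := IsFractionRing.div_surjective (A := MvPolynomial (Fin 2) k) z
    have h : ∀ p : MvPolynomial (Fin 2) k,
        algebraMap _ (Kxy k) p ∈ adjoin k {Xv k 0, Xv k 1} := by
      intro p
      induction p using MvPolynomial.induction_on with
      | C a =>
        rw [← MvPolynomial.algebraMap_eq, ← IsScalarTower.algebraMap_apply]
        exact IntermediateField.algebraMap_mem _ a
      | add p q hp hq => rw [map_add]; exact add_mem hp hq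
      | mul_X p i hp =>
        rw [map_mul]
        refine mul_mem hp (subset_adjoin _ _ ?_)
        fin_cases i <;> simp
    exact div_mem (h p) (h q)

namespace IsCoord

variable {x y u w : K}

omit [Field K] in
lemma range_eq (x y : K) : Set.range ![x, y] = {x, y} := by
  simp [Set.pair_comm]

lemma of_adjoin_eq_top (h : IsCoord k x y) (htop : adjoin k {u, w} = ⊤) : IsCoord k u w := by
  have hb : ∀ {a b : K}, adjoin k {a, b} = ⊤ →
      Algebra.IsAlgebraic (Algebra.adjoin k (Set.range ![a, b])) K := by
    intro a b hab
    rw [range_eq]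
    rw [← IntermediateField.isAlgebraic_adjoin_iff_top, hab]
    infer_instance
  have hx : IsTranscendenceBasis k ![x, y] := by
    have := hb h.adjoin_eq_top
    exact h.algebraicIndependent.isTranscendenceBasis_iff_isAlgebraic.2 (hb h.adjoin_eq_top)
  have := hb htop
  refine ⟨(Algebra.IsAlgebraic.isTranscendenceBasis_of_lift_le_trdeg_of_finite k ![u, w] ?_).1,
    htop⟩
  rw [← hx.lift_cardinalMk_eq_trdeg]

lemma transcendental_fst (h : IsCoord k x y) : Transcendental k x :=
  h.algebraicIndependent.transcendental 0

lemma symm (h : IsCoord k x y) : IsCoord k y x :=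
  h.of_adjoin_eq_top (by rw [Set.pair_comm]; exact h.adjoin_eq_top)

lemma transcendental_snd (h : IsCoord k x y) : Transcendental k⟮x⟯ y := by
  have := h.algebraicIndependent.transcendental_adjoin (s := {0}) (i := 1) (by decide)
  rw [Set.image_singleton, ← IntermediateField.transcendental_adjoin_iff] at this
  exact this

lemma adjoin_snd (h : IsCoord k x y) : k⟮x⟯⟮y⟯ = ⊤ := by
  rw [← restrictScalars_eq_top_iff (K := k), adjoin_simple_adjoin_simple, h.adjoin_eq_top]

lemma exists_algEquiv_Kxy (h : IsCoord k u w) :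
    ∃ e : Kxy k ≃ₐ[k] K, e (Xv k 0) = u ∧ e (Xv k 1) = w := by
  have e : adjoin k (Set.range ![u, w]) = ⊤ := by rw [range_eq]; exact h.adjoin_eq_top
  refine ⟨(h.algebraicIndependent.aevalEquivField.trans (equivOfEq e)).trans topEquiv, ?_, ?_⟩
  · change ((h.algebraicIndependent.aevalEquivField _ : adjoin k (Set.range ![u, w])) : K) = _
    rw [AlgebraicIndependent.aevalEquivField_algebraMap_apply_coe]; simp
  · change ((h.algebraicIndependent.aevalEquivField _ : adjoin k (Set.range ![u, w])) : K) = _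
    rw [AlgebraicIndependent.aevalEquivField_algebraMap_apply_coe]; simp

lemma exists_algEquiv (h : IsCoord k x y) (h' : IsCoord k u w) :
    ∃ φ : K ≃ₐ[k] K, φ x = u ∧ φ y = w := by
  obtain ⟨e, rfl, rfl⟩ := h.exists_algEquiv_Kxy
  obtain ⟨e', rfl, rfl⟩ := h'.exists_algEquiv_Kxy
  exact ⟨e.symm.trans e', by simp, by simp⟩

lemma map (h : IsCoord k x y) (φ : K ≃ₐ[k] K) : IsCoord k (φ x) (φ y) := by
  refine h.of_adjoin_eq_top ?_
  have h1 := adjoin_map k {x, y} φ.toAlgHom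
  rw [h.adjoin_eq_top, Set.image_pair] at h1
  rw [eq_top_iff]
  intro z _
  have h2 : z ∈ (⊤ : IntermediateField k K).map φ.toAlgHom := ⟨φ.symm z, trivial, by simp⟩
  rw [h1] at h2
  exact h2

end IsCoord
end Coordinates

section CoordGroup

open IntermediateField

variable {k K : Type*} [Field k] [Field K] [Algebra k K]

namespace IsCoord

variable {x y u w : K}

lemma of_mem (h : IsCoord k x y) (hx : x ∈ adjoin k {u, w}) (hy : y ∈ adjoin k {u, w}) :
    IsCoord k u w := by
  refine h.of_adjoin_eq_top (top_le_iff.1 ?_)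
  rw [← h.adjoin_eq_top, adjoin_le_iff]
  rintro z (rfl | rfl) <;> assumption

lemma algEquiv_ext (h : IsCoord k x y) {σ τ : K ≃ₐ[k] K} (hx : σ x = τ x) (hy : σ y = τ y) :
    σ = τ := by
  ext z
  have hz : z ∈ adjoin k {x, y} := h.adjoin_eq_top ▸ mem_top
  induction hz using IntermediateField.adjoin_induction with
  | mem z hz => rcases hz with rfl | rfl <;> assumption
  | algebraMap a => simp
  | add a b _ _ ha hb => simp [ha, hb]
  | inv a _ ha => simp [ha]
  | mul a b _ _ ha hb => simp [ha, hb]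

lemma fst_ne_zero (h : IsCoord k x y) : x ≠ 0 := fun h0 => h.transcendental_fst (h0 ▸ isAlgebraic_zero)

lemma snd_ne_zero (h : IsCoord k x y) : y ≠ 0 := h.symm.fst_ne_zero

lemma inv_fst (h : IsCoord k x y) : IsCoord k x⁻¹ y := by
  refine h.of_mem ?_ (subset_adjoin _ _ (by simp))
  simpa using inv_mem (subset_adjoin k {x⁻¹, y} (by simp : x⁻¹ ∈ ({x⁻¹, y} : Set K)))

lemma neg_fst (h : IsCoord k x y) : IsCoord k (-x) y := by
  refine h.of_mem ?_ (subset_adjoin _ _ (by simp))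
  simpa using neg_mem (subset_adjoin k {-x, y} (by simp : -x ∈ ({-x, y} : Set K)))

lemma mul_snd (h : IsCoord k x y) {z : K} (hz : z ∈ k⟮x⟯) (hz0 : z ≠ 0) :
    IsCoord k x (z * y) := by
  have hz' : z ∈ adjoin k {x, z * y} := adjoin.mono _ _ _ (by simp) hz
  refine h.of_mem (subset_adjoin _ _ (by simp)) ?_
  have := div_mem (subset_adjoin k {x, z * y} (by simp : z * y ∈ ({x, z * y} : Set K))) hz'
  rwa [mul_div_cancel_left₀ _ hz0] at this

end IsCoord

lemma Transcendental.ne_algebraMap {x : K} (h : Transcendental k x) (c : k) :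
    x ≠ algebraMap k K c :=
  fun hc => h (hc ▸ isAlgebraic_algebraMap c)

lemma fibreProd_mem (I : Finset k) {x : K} {F : IntermediateField k K} (hx : x ∈ F) :
    fibreProd I x ∈ F :=
  prod_mem fun a _ => sub_mem (add_mem (pow_mem hx 2) (inv_mem (pow_mem hx 2)))
    (F.algebraMap_mem a)

lemma map_fibreProd {L : Type*} [Field L] [Algebra k L] (f : K →ₐ[k] L) (I : Finset k) (x : K) :
    f (fibreProd I x) = fibreProd I (f x) := by
  simp [fibreProd]

lemma Transcendental.pow_two_add_inv {x : K} (h : Transcendental k x) :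
    Transcendental k (x ^ 2 + (x ^ 2)⁻¹) := by
  have hx0 : x ≠ 0 := fun h0 => h (h0 ▸ isAlgebraic_zero)
  intro halg
  let t : algebraicClosure k K := ⟨x ^ 2 + (x ^ 2)⁻¹, mem_algebraicClosure_iff.2 halg⟩
  have hx : IsAlgebraic (algebraicClosure k K) x := by
    refine ⟨Polynomial.X ^ 4 - Polynomial.C t * Polynomial.X ^ 2 + 1, fun h0 => ?_, ?_⟩
    · simpa using congrArg (fun q => Polynomial.coeff q 0) h0
    · have ht : algebraMap (algebraicClosure k K) K t = x ^ 2 + (x ^ 2)⁻¹ := rfl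
      simp only [map_add, map_sub, map_mul, map_pow, Polynomial.aeval_X, Polynomial.aeval_C,
        map_one, ht]
      field_simp
      ring
  exact h (hx.restrictScalars k)

lemma fibreProd_ne_zero (I : Finset k) {x : K} (h : Transcendental k x) : fibreProd I x ≠ 0 :=
  Finset.prod_ne_zero_iff.2 fun a _ => sub_ne_zero.2 (h.pow_two_add_inv.ne_algebraMap a)

/-- The group `G_I` written in the coordinates `x, y`. -/
def coordGroup (k : Type*) {K : Type*} [Field k] [Field K] [Algebra k K] (I : Finset k)
    (x y : K) : Subgroup (K ≃ₐ[k] K) :=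
  Subgroup.closure {σ : K ≃ₐ[k] K |
    (σ x = -x ∧ σ y = y) ∨ (σ x = x⁻¹ ∧ σ y = y) ∨ (σ x = x ∧ σ y = -y) ∨
    (σ x = x ∧ σ y = fibreProd I x * y⁻¹)}

lemma GI_eq_coordGroup (k : Type*) [Field k] (I : Finset k) :
    GI k I = coordGroup k I (Xv k 0) (Xv k 1) := rfl

lemma coordGroup_map (φ : K ≃ₐ[k] K) (I : Finset k) (x y : K) :
    (coordGroup k I x y).map (MulAut.conj φ).toMonoidHom = coordGroup k I (φ x) (φ y) := by
  rw [coordGroup, coordGroup, MonoidHom.map_closure]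
  congr 1
  ext σ
  simp only [Set.mem_image, Set.mem_ofPred_eq]
  have hP : φ (fibreProd I x) = fibreProd I (φ x) := map_fibreProd φ.toAlgHom I x
  constructor
  · rintro ⟨σ, h, rfl⟩
    have e : ∀ z, ((MulAut.conj φ).toMonoidHom σ) (φ z) = φ (σ z) := by
      intro z; simp [MulAut.conj_apply, AlgEquiv.mul_apply, AlgEquiv.aut_inv]
    simp only [e]
    rcases h with h | h | h | h <;> simp [h.1, h.2, hP]
  · intro h
    refine ⟨φ⁻¹ * σ * φ, ?_, by simp [MulAut.conj_apply, mul_assoc]⟩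
    simp only [AlgEquiv.mul_apply, AlgEquiv.aut_inv, AlgEquiv.symm_apply_eq]
    rcases h with h | h | h | h <;> simp [h.1, h.2, hP]

variable {x y : K}

lemma eq_of_sq_add_inv_eq {a b c : K} (ha : a ≠ 0) (hb : b ≠ 0)
    (h : a ^ 2 + c ^ 2 * (a ^ 2)⁻¹ = b ^ 2 + c ^ 2 * (b ^ 2)⁻¹) :
    a = b ∨ a = -b ∨ a = c * b⁻¹ ∨ a = -(c * b⁻¹) := by
  have h1 : (a - b) * (a + b) * ((a * b - c) * (a * b + c)) = 0 := by
    field_simp at h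
    linear_combination h
  rcases mul_eq_zero.1 h1 with h1 | h1 <;> rcases mul_eq_zero.1 h1 with h1 | h1
  · exact Or.inl (sub_eq_zero.1 h1)
  · exact Or.inr (Or.inl (eq_neg_of_add_eq_zero_left h1))
  · refine Or.inr (Or.inr (Or.inl ?_))
    field_simp
    linear_combination h1
  · refine Or.inr (Or.inr (Or.inr ?_))
    field_simp
    linear_combination h1

lemma mem_coordGroup_iff (h : IsCoord k x y) (I : Finset k) (σ : K ≃ₐ[k] K) :
    σ ∈ coordGroup k I x y ↔ σ (x ^ 2 + (x ^ 2)⁻¹) = x ^ 2 + (x ^ 2)⁻¹ ∧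
      σ (y ^ 2 + fibreProd I x ^ 2 * (y ^ 2)⁻¹) = y ^ 2 + fibreProd I x ^ 2 * (y ^ 2)⁻¹ := by
  have hP := fibreProd_ne_zero I h.transcendental_fst
  have hx0 := h.fst_ne_zero
  have hy0 := h.snd_ne_zero
  have hPσ : ∀ σ : K ≃ₐ[k] K, σ (x ^ 2 + (x ^ 2)⁻¹) = x ^ 2 + (x ^ 2)⁻¹ →
      σ (fibreProd I x) = fibreProd I x := by
    intro σ hσ
    rw [fibreProd, map_prod]
    exact Finset.prod_congr rfl fun a _ => by rw [map_sub, hσ, AlgEquiv.commutes]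
  constructor
  · intro hσ
    induction hσ using Subgroup.closure_induction with
    | mem σ hσ =>
      have h1 : σ (x ^ 2 + (x ^ 2)⁻¹) = x ^ 2 + (x ^ 2)⁻¹ := by
        rcases hσ with h | h | h | h <;> simp [h.1, add_comm]
      refine ⟨h1, ?_⟩
      simp only [map_add, map_mul, map_pow, map_inv₀, hPσ σ h1]
      rcases hσ with h | h | h | h <;> simp only [h.2]
      · ring
      · field_simp; ring
    | one => simp
    | mul σ τ _ _ hσ hτ => simp only [AlgEquiv.mul_apply, hσ.1, hσ.2, hτ.1, hτ.2, and_self]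
    | inv σ _ hσ =>
      simp only [AlgEquiv.aut_inv, AlgEquiv.symm_apply_eq, hσ.1, hσ.2, and_self]
  · rintro ⟨h1, h2⟩
    have hx : ∃ g ∈ coordGroup k I x y, g x = σ x ∧ g y = y := by
      have e1 : ∃ g ∈ coordGroup k I x y, g x = -x ∧ g y = y := by
        obtain ⟨g, hg⟩ := h.exists_algEquiv h.neg_fst
        exact ⟨g, Subgroup.subset_closure (Or.inl hg), hg⟩
      have e2 : ∃ g ∈ coordGroup k I x y, g x = x⁻¹ ∧ g y = y := by
        obtain ⟨g, hg⟩ := h.exists_algEquiv h.inv_fst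
        exact ⟨g, Subgroup.subset_closure (Or.inr (Or.inl hg)), hg⟩
      have h1' := eq_of_sq_add_inv_eq (a := σ x) (b := x) (c := 1) (by simpa) hx0 (by simpa using h1)
      simp only [one_mul] at h1'
      rcases h1' with h1' | h1' | h1' | h1' <;> rw [h1']
      · exact ⟨1, one_mem _, rfl, rfl⟩
      · exact e1
      · exact e2
      · obtain ⟨g, hg, hgx, hgy⟩ := e1
        obtain ⟨g', hg', hgx', hgy'⟩ := e2
        exact ⟨g * g', mul_mem hg hg', by simp [hgx', hgx, inv_neg], by simp [hgy', hgy]⟩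
    have hy : ∃ g ∈ coordGroup k I x y, g x = x ∧ g y = σ y := by
      have e1 : ∃ g ∈ coordGroup k I x y, g x = x ∧ g y = -y := by
        obtain ⟨g, hg⟩ := h.exists_algEquiv h.symm.neg_fst.symm
        exact ⟨g, Subgroup.subset_closure (Or.inr (Or.inr (Or.inl hg))), hg⟩
      have e2 : ∃ g ∈ coordGroup k I x y, g x = x ∧ g y = fibreProd I x * y⁻¹ := by
        obtain ⟨g, hg⟩ := h.exists_algEquiv
          (h.symm.inv_fst.symm.mul_snd (fibreProd_mem I (mem_adjoin_simple_self k x)) hP)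
        exact ⟨g, Subgroup.subset_closure (Or.inr (Or.inr (Or.inr hg))), hg⟩
      have h2' := eq_of_sq_add_inv_eq (a := σ y) (b := y) (c := fibreProd I x) (by simpa) hy0
        (by simpa [hPσ σ h1] using h2)
      rcases h2' with h2' | h2' | h2' | h2' <;> rw [h2']
      · exact ⟨1, one_mem _, rfl, rfl⟩
      · exact e1
      · exact e2
      · obtain ⟨g, hg, hgx, hgy⟩ := e1
        obtain ⟨g', hg', hgx', hgy'⟩ := e2
        refine ⟨g' * g, mul_mem hg' hg, by simp [hgx', hgx], by simp [hgy', hgy]⟩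
    obtain ⟨g, hg, hgx, hgy⟩ := hx
    obtain ⟨g', hg', hgx', hgy'⟩ := hy
    have : σ = g' * g := by
      refine h.algEquiv_ext ?_ (by simp [hgy, hgy'])
      have h3 := eq_of_sq_add_inv_eq (a := σ x) (b := x) (c := 1) (by simpa) hx0 (by simpa using h1)
      rw [AlgEquiv.mul_apply, hgx]
      rcases h3 with h3 | h3 | h3 | h3 <;> simp [h3, hgx']
    rw [this]
    exact mul_mem hg' hg

lemma apply_fst_of_mem_coordGroup (h : IsCoord k x y) {I : Finset k} {σ : K ≃ₐ[k] K}
    (hσ : σ ∈ coordGroup k I x y) : σ x = x ∨ σ x = -x ∨ σ x = x⁻¹ ∨ σ x = -x⁻¹ := by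
  simpa using eq_of_sq_add_inv_eq (a := σ x) (b := x) (c := 1) (by simpa using h.fst_ne_zero)
    h.fst_ne_zero (by simpa using ((mem_coordGroup_iff h I σ).1 hσ).1)

lemma map_fibreProd_of_mem_coordGroup (h : IsCoord k x y) {I : Finset k} {σ : K ≃ₐ[k] K}
    (hσ : σ ∈ coordGroup k I x y) (J : Finset k) : σ (fibreProd J x) = fibreProd J x := by
  rw [fibreProd, map_prod]
  exact Finset.prod_congr rfl fun a _ => by
    rw [map_sub, ((mem_coordGroup_iff h I σ).1 hσ).1, AlgEquiv.commutes]

lemma apply_snd_of_mem_coordGroup (h : IsCoord k x y) {I : Finset k} {σ : K ≃ₐ[k] K}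
    (hσ : σ ∈ coordGroup k I x y) :
    σ y = y ∨ σ y = -y ∨ σ y = fibreProd I x * y⁻¹ ∨ σ y = -(fibreProd I x * y⁻¹) :=
  eq_of_sq_add_inv_eq (by simpa using h.snd_ne_zero) h.snd_ne_zero
    (by simpa [map_fibreProd_of_mem_coordGroup h hσ I] using
      ((mem_coordGroup_iff h I σ).1 hσ).2)

end CoordGroup

section Places

open IntermediateField Polynomial

/-- A place of the field extension `K / k` with values in the field `Ω`, given by its graph. -/
structure Place (k K Ω : Type*) [Field k] [Field K] [Field Ω] [Algebra k K] [Algebra k Ω] where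
  /-- The graph of the place. -/
  graph : Subalgebra k (K × Ω)
  eq_zero : ∀ ω, ((0 : K), ω) ∈ graph → ω = 0
  total : ∀ z, (∃ ω, (z, ω) ∈ graph) ∨ (z⁻¹, (0 : Ω)) ∈ graph

namespace Place

variable {k K Ω : Type*} [Field k] [Field K] [Field Ω] [Algebra k K] [Algebra k Ω]
  (P : Place k K Ω) {a b : K} {α β : Ω}

lemma unique (h : (a, α) ∈ P.graph) (h' : (a, β) ∈ P.graph) : α = β :=
  sub_eq_zero.1 (P.eq_zero _ (by simpa using sub_mem h h'))

lemma add (h : (a, α) ∈ P.graph) (h' : (b, β) ∈ P.graph) : (a + b, α + β) ∈ P.graph :=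
  add_mem h h'

lemma sub (h : (a, α) ∈ P.graph) (h' : (b, β) ∈ P.graph) : (a - b, α - β) ∈ P.graph :=
  sub_mem h h'

lemma neg (h : (a, α) ∈ P.graph) : (-a, -α) ∈ P.graph := neg_mem h

lemma mul (h : (a, α) ∈ P.graph) (h' : (b, β) ∈ P.graph) : (a * b, α * β) ∈ P.graph :=
  mul_mem h h'

lemma pow (h : (a, α) ∈ P.graph) (n : ℕ) : (a ^ n, α ^ n) ∈ P.graph := pow_mem h n

lemma one : ((1 : K), (1 : Ω)) ∈ P.graph := one_mem _

lemma zero : ((0 : K), (0 : Ω)) ∈ P.graph := zero_mem _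

lemma algebraMap (c : k) : (algebraMap k K c, algebraMap k Ω c) ∈ P.graph :=
  P.graph.algebraMap_mem c

lemma inv (h : (a, α) ∈ P.graph) (hα : α ≠ 0) : (a⁻¹, α⁻¹) ∈ P.graph := by
  have ha : a ≠ 0 := by
    rintro rfl
    exact hα (P.eq_zero _ h)
  rcases P.total a⁻¹ with ⟨β, hβ⟩ | h0
  · have h1 := P.mul h hβ
    rw [mul_inv_cancel₀ ha] at h1
    rwa [inv_eq_of_mul_eq_one_right (P.unique h1 P.one)]
  · rw [inv_inv] at h0
    exact absurd (P.unique h h0) hα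

lemma not_mem_of_inv (ha : a ≠ 0) (h : (a⁻¹, (0 : Ω)) ∈ P.graph) : (a, α) ∉ P.graph := by
  intro h'
  have := P.mul h h'
  rw [inv_mul_cancel₀ ha, zero_mul] at this
  exact one_ne_zero (P.unique P.one this)

lemma fibreProd (h : (a, α) ∈ P.graph) (hα : α ≠ 0) (I : Finset k) :
    (fibreProd I a, fibreProd I α) ∈ P.graph := by
  induction I using Finset.induction_on with
  | empty => exact P.one
  | insert c I hc ih =>
    simp only [_root_.fibreProd, Finset.prod_insert hc] at ih ⊢
    exact P.mul (P.sub (P.add (P.pow h 2) (P.inv (P.pow h 2) (pow_ne_zero 2 hα)))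
      (P.algebraMap c)) ih

/-- The pullback of a place along an automorphism. -/
def comap (φ : K ≃ₐ[k] K) : Place k K Ω where
  graph := P.graph.comap (φ.toAlgHom.prodMap (AlgHom.id k Ω))
  eq_zero ω h := P.eq_zero ω (by
    change (φ 0, ω) ∈ P.graph at h
    rwa [map_zero] at h)
  total z := by
    rcases P.total (φ z) with h | h
    · exact Or.inl h
    · right
      change (φ z⁻¹, (0 : Ω)) ∈ P.graph
      rwa [map_inv₀]

lemma mem_comap (φ : K ≃ₐ[k] K) : (a, α) ∈ (P.comap φ).graph ↔ (φ a, α) ∈ P.graph := Iff.rfl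

end Place

section AdjoinRootPlace

variable {k E K Ω : Type*} [Field k] [Field E] [Field K] [Field Ω] [Algebra k E] [Algebra E K]
  [Algebra k K] [IsScalarTower k E K] [Algebra k Ω]

lemma exists_aeval_eq_of_adjoin_eq_top {w : K} (hw : Transcendental E w) (htop : E⟮w⟯ = ⊤)
    (z : K) : ∃ a b : E[X], IsCoprime a b ∧ b ≠ 0 ∧ z * aeval w b = aeval w a := by
  have hz : z ∈ E⟮w⟯ := htop ▸ mem_top
  obtain ⟨a, b, rfl⟩ := (mem_adjoin_simple_iff E z).1 hz
  by_cases hb : b = 0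
  · exact ⟨0, 1, isCoprime_one_right, one_ne_zero, by simp [hb]⟩
  have hg : gcd a b ≠ 0 := fun h => hb ((gcd_eq_zero_iff _ _).1 h).2
  have ea : gcd a b * (a / gcd a b) = a := EuclideanDomain.mul_div_cancel' hg (gcd_dvd_left a b)
  have eb : gcd a b * (b / gcd a b) = b := EuclideanDomain.mul_div_cancel' hg (gcd_dvd_right a b)
  have hb' : b / gcd a b ≠ 0 := fun h => hb (by rw [← eb, h, mul_zero])
  refine ⟨a / gcd a b, b / gcd a b, isCoprime_div_gcd_div_gcd hb, hb', ?_⟩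
  have hg' : aeval w (gcd a b) ≠ 0 := fun h => hg (transcendental_iff.1 hw _ h)
  have hb'' : aeval w (b / gcd a b) ≠ 0 := fun h => hb' (transcendental_iff.1 hw _ h)
  have ea' := congrArg (aeval w) ea
  have eb' := congrArg (aeval w) eb
  rw [map_mul] at ea' eb'
  rw [← ea', ← eb', mul_div_mul_left _ _ hg', div_mul_cancel₀ _ hb'']

/-- The place of the rational function field `K = E(w)` defined by an irreducible polynomial. -/
noncomputable def adjoinRootPlace (k : Type*) {E K : Type*} [Field k] [Field E] [Field K]
    [Algebra k E] [Algebra E K] [Algebra k K] [IsScalarTower k E K] (p : E[X])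
    [hp : Fact (Irreducible p)] (w : K) (hw : Transcendental E w) (htop : E⟮w⟯ = ⊤) :
    Place k K (AdjoinRoot p) where
  graph :=
    { carrier := {z | ∃ a b : E[X], ¬ p ∣ b ∧ z.1 * aeval w b = aeval w a ∧
        z.2 * AdjoinRoot.mk p b = AdjoinRoot.mk p a}
      mul_mem' := by
        rintro ⟨z, ω⟩ ⟨z', ω'⟩ ⟨a, b, hb, h1, h2⟩ ⟨a', b', hb', h1', h2'⟩
        refine ⟨a * a', b * b', fun h => (hp.out.prime.dvd_or_dvd h).elim hb hb', ?_, ?_⟩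
        · simp only [map_mul, ← h1, ← h1', Prod.mk_mul_mk]; ring
        · simp only [map_mul, ← h2, ← h2', Prod.mk_mul_mk]; ring
      add_mem' := by
        rintro ⟨z, ω⟩ ⟨z', ω'⟩ ⟨a, b, hb, h1, h2⟩ ⟨a', b', hb', h1', h2'⟩
        refine ⟨a * b' + a' * b, b * b', fun h => (hp.out.prime.dvd_or_dvd h).elim hb hb', ?_, ?_⟩
        · simp only [map_mul, map_add, ← h1, ← h1', Prod.mk_add_mk]; ring
        · simp only [map_mul, map_add, ← h2, ← h2', Prod.mk_add_mk]; ring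
      algebraMap_mem' := fun c => by
        refine ⟨C (algebraMap k E c), 1, hp.out.not_dvd_one, ?_, ?_⟩
        · simp [← IsScalarTower.algebraMap_apply]
        · simp only [map_one, mul_one, AdjoinRoot.mk_C]
          rfl }
  eq_zero := by
    rintro ω ⟨a, b, hb, h1, h2⟩
    have ha : a = 0 := (transcendental_iff.1 hw) a (by simpa using h1.symm)
    simp only [ha, map_zero, mul_eq_zero, AdjoinRoot.mk_eq_zero, hb, or_false] at h2
    exact h2
  total := by
    intro z
    obtain ⟨a, b, hab, hb0, h⟩ := exists_aeval_eq_of_adjoin_eq_top hw htop z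
    by_cases hb : p ∣ b
    · right
      have ha : ¬ p ∣ a := fun ha => hp.out.not_isUnit (hab.isUnit_of_dvd' ha hb)
      refine ⟨b, a, ha, ?_, ?_⟩
      · have : aeval w a ≠ 0 := fun h0 => ha (by rw [transcendental_iff.1 hw a h0]; exact dvd_zero _)
        have hz : z ≠ 0 := by rintro rfl; exact this (by rw [← h, zero_mul])
        rw [← h, inv_mul_cancel_left₀ hz]
      · simpa using ((AdjoinRoot.mk_eq_zero).2 hb).symm
    · left
      refine ⟨AdjoinRoot.mk p a / AdjoinRoot.mk p b, a, b, hb, h, ?_⟩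
      rw [div_mul_cancel₀]
      rwa [Ne, AdjoinRoot.mk_eq_zero]

lemma aeval_mem_adjoinRootPlace {p : E[X]} [hp : Fact (Irreducible p)] {w : K}
    {hw : Transcendental E w} {htop : E⟮w⟯ = ⊤} (a : E[X]) :
    (aeval w a, AdjoinRoot.mk p a) ∈ (adjoinRootPlace k p w hw htop).graph :=
  ⟨a, 1, hp.out.not_dvd_one, by simp, by simp⟩

lemma algebraMap_mem_adjoinRootPlace {p : E[X]} [hp : Fact (Irreducible p)] {w : K}
    {hw : Transcendental E w} {htop : E⟮w⟯ = ⊤} (e : E) :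
    (algebraMap E K e, AdjoinRoot.of p e) ∈ (adjoinRootPlace k p w hw htop).graph := by
  simpa using aeval_mem_adjoinRootPlace (k := k) (hw := hw) (htop := htop) (p := p) (C e)

lemma root_mem_adjoinRootPlace {p : E[X]} [hp : Fact (Irreducible p)] {w : K}
    {hw : Transcendental E w} {htop : E⟮w⟯ = ⊤} :
    (w, AdjoinRoot.root p) ∈ (adjoinRootPlace k p w hw htop).graph := by
  simpa using aeval_mem_adjoinRootPlace (k := k) (hw := hw) (htop := htop) (p := p) X

lemma exists_algHom_of_place {p : E[X]} [hp : Fact (Irreducible p)] {w : K}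
    (hw : Transcendental E w) (htop : E⟮w⟯ = ⊤) (P : Place k K Ω)
    (hE : ∀ e : E, ∃ ω, (algebraMap E K e, ω) ∈ P.graph) (hwP : ∃ ω, (w, ω) ∈ P.graph)
    (hpP : (aeval w p, (0 : Ω)) ∈ P.graph) :
    ∃ ψ : AdjoinRoot p →ₐ[k] Ω, ∀ z ω, (z, ω) ∈ (adjoinRootPlace k p w hw htop).graph →
      (z, ψ ω) ∈ P.graph := by
  choose ε hε using hE
  obtain ⟨r, hr⟩ := hwP
  let ε' : E →ₐ[k] Ω :=
    { toFun := ε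
      map_one' := P.unique (hε 1) (by simpa using P.one)
      map_mul' := fun a b => P.unique (hε _) (by simpa using P.mul (hε a) (hε b))
      map_zero' := P.unique (hε 0) (by simpa using P.zero)
      map_add' := fun a b => P.unique (hε _) (by simpa using P.add (hε a) (hε b))
      commutes' := fun c => P.unique (hε _)
        (by simpa [← IsScalarTower.algebraMap_apply] using P.algebraMap c) }
  have hev : ∀ q : E[X], (aeval w q, q.eval₂ (ε' : E →+* Ω) r) ∈ P.graph := by
    intro q
    induction q using Polynomial.induction_on' with
    | add p q hp hq => rw [map_add, eval₂_add]; exact P.add hp hq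
    | monomial n a =>
      rw [aeval_monomial, eval₂_monomial]
      exact P.mul (hε a) (P.pow hr n)
  have hroot : p.eval₂ (ε' : E →+* Ω) r = 0 := P.unique (hev p) hpP
  refine ⟨AdjoinRoot.liftAlgHom p ε' r hroot, ?_⟩
  rintro z ω ⟨a, b, hb, h1, h2⟩
  simp only at h1 h2
  have hb0 : aeval w b ≠ 0 := fun h0 => hb (by rw [transcendental_iff.1 hw b h0]; exact dvd_zero _)
  have hmk : ∀ q, AdjoinRoot.liftAlgHom p ε' r hroot (AdjoinRoot.mk p q) =
      q.eval₂ (ε' : E →+* Ω) r := fun q => AdjoinRoot.lift_mk hroot q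
  have hbΩ : b.eval₂ (ε' : E →+* Ω) r ≠ 0 := by
    rw [← hmk, Ne, map_eq_zero, AdjoinRoot.mk_eq_zero]
    exact hb
  have hω := congrArg (AdjoinRoot.liftAlgHom p ε' r hroot) h2
  rw [map_mul, hmk, hmk] at hω
  have := P.mul (hev a) (P.inv (hev b) hbΩ)
  rwa [← h1, ← hω, mul_inv_cancel_right₀ hb0, mul_inv_cancel_right₀ hbΩ] at this

end AdjoinRootPlace

end Places

section Derivations

open IntermediateField

lemma exists_derivation_Kxy (k : Type*) [Field k] (a b : Kxy k) :
    ∃ D : Derivation k (Kxy k) (Kxy k), D (Xv k 0) = a ∧ D (Xv k 1) = b := by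
  let A := MvPolynomial (Fin 2) k
  have : Algebra.FormallyEtale A (Kxy k) :=
    Algebra.FormallyEtale.of_isLocalization (nonZeroDivisors A)
  let d : Derivation k A (Kxy k) := MvPolynomial.mkDerivation k ![a, b]
  let l := (KaehlerDifferential.isBaseChange_of_formallyEtale k A (Kxy k)).lift d.liftKaehlerDifferential
  have hl : ∀ z : A, l (KaehlerDifferential.D k (Kxy k) (algebraMap A (Kxy k) z)) = d z := by
    intro z
    have := (KaehlerDifferential.isBaseChange_of_formallyEtale k A (Kxy k)).lift_eq
      d.liftKaehlerDifferential (KaehlerDifferential.D k A z)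
    rw [KaehlerDifferential.map_D, Derivation.liftKaehlerDifferential_comp_D] at this
    exact this
  refine ⟨l.compDer (KaehlerDifferential.D k (Kxy k)), ?_, ?_⟩
  · exact (hl (MvPolynomial.X 0)).trans (MvPolynomial.mkDerivation_X k _ 0)
  · exact (hl (MvPolynomial.X 1)).trans (MvPolynomial.mkDerivation_X k _ 1)

variable {k K : Type*} [Field k] [Field K] [Algebra k K]

lemma Derivation.apply_inv (D : Derivation k K K) (a : K) : D a⁻¹ = -(a⁻¹ ^ 2 * D a) := by
  rw [Derivation.leibniz_inv, neg_smul, smul_eq_mul]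

lemma Derivation.apply_div (D : Derivation k K K) (a : K) {b : K} (hb : b ≠ 0) :
    D (a / b) = (b * D a - a * D b) / b ^ 2 := by
  rw [div_eq_mul_inv, Derivation.leibniz, Derivation.apply_inv, smul_eq_mul, smul_eq_mul]
  field_simp
  ring

namespace IsCoord

variable {x y u w : K}

lemma exists_derivation (h : IsCoord k u w) (a b : K) :
    ∃ D : Derivation k K K, D u = a ∧ D w = b := by
  obtain ⟨e, rfl, rfl⟩ := h.exists_algEquiv_Kxy
  obtain ⟨D, h0, h1⟩ := exists_derivation_Kxy k (e.symm a) (e.symm b)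
  refine ⟨Derivation.mk' (e.toLinearMap ∘ₗ (D : Kxy k →ₗ[k] Kxy k) ∘ₗ e.symm.toLinearMap)
    fun a b => ?_, ?_, ?_⟩
  · simp
  · change e (D (e.symm (e (Xv k 0)))) = a
    rw [e.symm_apply_apply, h0, e.apply_symm_apply]
  · change e (D (e.symm (e (Xv k 1)))) = b
    rw [e.symm_apply_apply, h1, e.apply_symm_apply]

lemma derivation_eq_zero (h : IsCoord k x y) (D : Derivation k K K) (hx : D x = 0) (hy : D y = 0)
    (z : K) : D z = 0 := by
  have hz : z ∈ adjoin k {x, y} := h.adjoin_eq_top ▸ mem_top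
  induction hz using IntermediateField.adjoin_induction with
  | mem z hz => rcases hz with rfl | rfl <;> assumption
  | algebraMap a => simp
  | add a b _ _ ha hb => simp [ha, hb]
  | inv a _ ha => simp [Derivation.apply_inv, ha]
  | mul a b _ _ ha hb => simp [ha, hb]

/-- The Jacobian determinant of a pair of coordinates does not vanish. -/
lemma jacobian_ne_zero (h : IsCoord k x y) {D₁ D₂ : Derivation k K K}
    (h1u : D₁ u = 1) (h1w : D₁ w = 0) (h2u : D₂ u = 0) (h2w : D₂ w = 1) :
    D₁ x * D₂ y - D₂ x * D₁ y ≠ 0 := by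
  intro hJ
  have key : ∀ α β : K, α * D₁ x + β * D₂ x = 0 → α * D₁ y + β * D₂ y = 0 → α = 0 ∧ β = 0 := by
    intro α β hx hy
    have := h.derivation_eq_zero (α • D₁ + β • D₂) (by simpa using hx) (by simpa using hy)
    have hu := this u
    have hw := this w
    simp [h1u, h1w, h2u, h2w] at hu hw
    exact ⟨hu, hw⟩
  have hx := key (D₂ x) (-D₁ x) (by ring) (by linear_combination -hJ)
  have hy := key (D₂ y) (-D₁ y) (by linear_combination hJ) (by ring)
  exact one_ne_zero (key 1 0 (by linear_combination -hx.2) (by linear_combination -hy.2)).1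

end IsCoord

end Derivations

section RuledResidueField

open IntermediateField Polynomial

variable {k K : Type*} [Field k] [Field K] [Algebra k K]

namespace IsCoord

variable {x y : K}

lemma div_snd (h : IsCoord k x y) : IsCoord k x (y / x) := by
  rw [div_eq_inv_mul]
  exact h.mul_snd (inv_mem (mem_adjoin_simple_self k x)) (inv_ne_zero h.fst_ne_zero)

lemma sub_algebraMap (h : IsCoord k x y) (c : k) : IsCoord k x (y - algebraMap k K c) := by
  refine h.of_mem (subset_adjoin _ _ (by simp)) ?_
  have := add_mem (subset_adjoin k {x, y - algebraMap k K c}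
    (by simp : y - algebraMap k K c ∈ ({x, y - algebraMap k K c} : Set K)))
    (IntermediateField.algebraMap_mem _ c)
  rwa [sub_add_cancel] at this

end IsCoord

lemma exists_algebraMap_eq_of_isAlgebraic [IsAlgClosed k] {a : K} (h : IsAlgebraic k a) :
    ∃ c, algebraMap k K c = a :=
  minpoly.mem_range_of_degree_eq_one k a
    (IsAlgClosed.degree_eq_one_of_irreducible k (minpoly.irreducible h.isIntegral))

namespace Place

variable {Ω : Type*} [Field Ω] [Algebra k Ω] (P : Place k K Ω)

lemma exists_value_of_mem_adjoin {y : K} {η : Ω} (h : (y, η) ∈ P.graph) (hη : Transcendental k η)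
    {e : K} (he : e ∈ k⟮y⟯) : ∃ ω ∈ k⟮η⟯, (e, ω) ∈ P.graph := by
  obtain ⟨a, b, rfl⟩ := (mem_adjoin_simple_iff k e).1 he
  have hev : ∀ q : k[X], (aeval y q, aeval η q) ∈ P.graph := by
    intro q
    have := P.graph.toSubmodule
    induction q using Polynomial.induction_on' with
    | add p q hp hq => rw [map_add, map_add]; exact P.add hp hq
    | monomial n a =>
      rw [aeval_monomial, aeval_monomial]
      exact P.mul (P.algebraMap a) (P.pow h n)
  by_cases hb : b = 0
  · exact ⟨0, zero_mem _, by simpa [hb] using P.zero⟩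
  · have hb' : aeval η b ≠ 0 := fun h0 => hb (transcendental_iff.1 hη b h0)
    refine ⟨aeval η a / aeval η b, (mem_adjoin_simple_iff k _).2 ⟨a, b, rfl⟩, ?_⟩
    rw [div_eq_mul_inv, div_eq_mul_inv]
    exact P.mul (hev a) (P.inv (hev b) hb')

/-- A place at which the first coordinate vanishes, and at which the second one has a
transcendental value, has its values in the field generated by this value. -/
lemma mem_adjoin_of_transcendental {x y : K} (hxy : IsCoord k x y) (hx : (x, (0 : Ω)) ∈ P.graph)
    {η : Ω} (hy : (y, η) ∈ P.graph) (hη : Transcendental k η) {z : K} {ω : Ω}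
    (hz : (z, ω) ∈ P.graph) : ω ∈ k⟮η⟯ := by
  have hp : Fact (Irreducible (X : k⟮y⟯[X])) := ⟨irreducible_X⟩
  obtain ⟨ψ, hψ⟩ := exists_algHom_of_place (p := (X : k⟮y⟯[X])) hxy.symm.transcendental_snd
    hxy.symm.adjoin_snd P
    (fun e => (P.exists_value_of_mem_adjoin hy hη e.2).imp fun _ h => h.2) ⟨0, hx⟩ (by simpa)
  rcases (adjoinRootPlace k (X : k⟮y⟯[X]) x hxy.symm.transcendental_snd
    hxy.symm.adjoin_snd).total z with ⟨ω', hω'⟩ | h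
  · rw [P.unique hz (hψ _ _ hω')]
    obtain ⟨a, rfl⟩ := AdjoinRoot.mk_surjective ω'
    have ha : AdjoinRoot.mk X a = AdjoinRoot.of X (a.coeff 0) := by
      rw [← AdjoinRoot.mk_C, AdjoinRoot.mk_eq_mk, X_dvd_iff]
      simp
    obtain ⟨ω₁, hω₁, h1⟩ := P.exists_value_of_mem_adjoin hy hη (a.coeff 0).2
    rw [ha, P.unique (hψ _ _ (algebraMap_mem_adjoinRootPlace (a.coeff 0))) h1]
    exact hω₁
  · by_cases hz0 : z = 0
    · rw [hz0] at hz
      rw [P.eq_zero _ hz]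
      exact zero_mem _
    · exact absurd hz (P.not_mem_of_inv hz0 (by simpa using hψ _ _ h))

end Place

variable {u w : K} (h : IsCoord k u w) {p : k⟮u⟯[X]} [hp : Fact (Irreducible p)]
  {hw : Transcendental k⟮u⟯ w} {htop : k⟮u⟯⟮w⟯ = ⊤}

local notation "𝓟" => adjoinRootPlace k p w hw htop

include hp in
lemma exists_eq_mul_of_mem_adjoinRootPlace {z : K} (hz : (z, (0 : AdjoinRoot p)) ∈ (𝓟).graph) :
    ∃ z' ω, (z', ω) ∈ (𝓟).graph ∧ z = aeval w p * z' := by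
  obtain ⟨a, b, hb, h1, h2⟩ := hz
  simp only [zero_mul] at h1 h2
  obtain ⟨a', rfl⟩ := AdjoinRoot.mk_eq_zero.1 h2.symm
  have hb0 : aeval w b ≠ 0 := fun h0 => hb (by rw [transcendental_iff.1 hw b h0]; exact dvd_zero _)
  have hb' : AdjoinRoot.mk p b ≠ 0 := by rwa [Ne, AdjoinRoot.mk_eq_zero]
  refine ⟨aeval w a' / aeval w b, AdjoinRoot.mk p a' / AdjoinRoot.mk p b,
    ⟨a', b, hb, div_mul_cancel₀ _ hb0, div_mul_cancel₀ _ hb'⟩, ?_⟩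
  rw [map_mul] at h1
  field_simp
  exact h1

include hp in
lemma exists_not_mem_adjoinRootPlace {z : K} (hz : z ≠ 0) :
    ∃ n : ℕ, ∀ ω, (z / aeval w p ^ n, ω) ∉ (𝓟).graph := by
  obtain ⟨a, b, hab, hb, h1⟩ := exists_aeval_eq_of_adjoin_eq_top hw htop z
  have hb0 : aeval w b ≠ 0 := fun h0 => hb (transcendental_iff.1 hw b h0)
  have ha : a ≠ 0 := by
    rintro rfl
    rw [map_zero] at h1
    exact (mul_ne_zero hz hb0) h1
  have hpw : aeval w p ≠ 0 := fun h0 => hp.out.ne_zero (transcendental_iff.1 hw p h0)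
  obtain ⟨n, hn⟩ := (FiniteMultiplicity.of_prime_left hp.out.prime ha)
  refine ⟨n + 1, ?_⟩
  rintro ω ⟨c, d, hd, h2, -⟩
  simp only at h2
  have h3 : aeval w (a * d) = aeval w (c * b * p ^ (n + 1)) := by
    simp only [map_mul, map_pow]
    rw [← h1, ← h2]
    field_simp
  have h4 : a * d = c * b * p ^ (n + 1) := by
    rw [← sub_eq_zero]
    exact transcendental_iff.1 hw _ (by rw [map_sub, h3, sub_self])
  exact hn ((hp.out.prime.pow_dvd_of_dvd_mul_right _ hd ⟨c * b, by rw [h4]; ring⟩))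

include hp in
lemma derivation_mem_adjoinRootPlace (D : Derivation k K K)
    (hu : ∃ ω, (D u, ω) ∈ (𝓟).graph) (hDw : ∃ ω, (D w, ω) ∈ (𝓟).graph) {z : K} {ω : AdjoinRoot p}
    (hz : (z, ω) ∈ (𝓟).graph) : ∃ ω', (D z, ω') ∈ (𝓟).graph := by
  have hE : ∀ e ∈ k⟮u⟯, ∃ ω, (e, ω) ∈ (𝓟).graph :=
    fun e he => ⟨_, algebraMap_mem_adjoinRootPlace (⟨e, he⟩ : k⟮u⟯)⟩
  have hDE : ∀ e ∈ k⟮u⟯, ∃ ω, (D e, ω) ∈ (𝓟).graph := by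
    intro e he
    induction he using IntermediateField.adjoin_induction with
    | mem z hz => rw [Set.mem_singleton_iff.1 hz]; exact hu
    | algebraMap a => exact ⟨0, by simpa using (𝓟).zero⟩
    | add a b _ _ ha hb =>
      obtain ⟨α, hα⟩ := ha
      obtain ⟨β, hβ⟩ := hb
      exact ⟨_, by rw [map_add]; exact (𝓟).add hα hβ⟩
    | inv a ha' ha =>
      obtain ⟨α, hα⟩ := ha
      obtain ⟨β, hβ⟩ := hE a⁻¹ (inv_mem ha')
      exact ⟨_, by rw [Derivation.apply_inv]; exact (𝓟).neg ((𝓟).mul ((𝓟).pow hβ 2) hα)⟩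
    | mul a b ha' hb' ha hb =>
      obtain ⟨α, hα⟩ := ha
      obtain ⟨β, hβ⟩ := hb
      obtain ⟨α', hα'⟩ := hE a ha'
      obtain ⟨β', hβ'⟩ := hE b hb'
      exact ⟨_, by
        rw [Derivation.leibniz]; exact (𝓟).add ((𝓟).mul hα' hβ) ((𝓟).mul hβ' hα)⟩
  have hpoly : ∀ a : k⟮u⟯[X], ∃ ω, (D (aeval w a), ω) ∈ (𝓟).graph := by
    intro a
    induction a using Polynomial.induction_on with
    | C a => rw [aeval_C]; exact hDE _ a.2
    | add p q hp hq =>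
      obtain ⟨α, hα⟩ := hp
      obtain ⟨β, hβ⟩ := hq
      exact ⟨_, by rw [map_add, map_add]; exact (𝓟).add hα hβ⟩
    | monomial n a ha =>
      obtain ⟨α, hα⟩ := ha
      obtain ⟨β, hβ⟩ := hDw
      exact ⟨_, by
        rw [pow_succ, ← mul_assoc, map_mul, Derivation.leibniz, aeval_X]
        exact (𝓟).add ((𝓟).mul (aeval_mem_adjoinRootPlace _) hβ)
          ((𝓟).mul root_mem_adjoinRootPlace hα)⟩
  have hz' := hz
  obtain ⟨a, b, hb, h1, h2⟩ := hz'
  simp only at h1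
  have hb0 : aeval w b ≠ 0 := fun h0 => hb (by rw [transcendental_iff.1 hw b h0]; exact dvd_zero _)
  have hb' : AdjoinRoot.mk p b ≠ 0 := by rwa [Ne, AdjoinRoot.mk_eq_zero]
  have h3 := congrArg D h1
  rw [Derivation.leibniz, smul_eq_mul, smul_eq_mul] at h3
  obtain ⟨α, hα⟩ := hpoly a
  obtain ⟨β, hβ⟩ := hpoly b
  have h4 : D z = (D (aeval w a) - z * D (aeval w b)) * (aeval w b)⁻¹ := by
    rw [← h3]
    field_simp
    ring
  rw [h4]
  exact ⟨_, (𝓟).mul ((𝓟).sub hα ((𝓟).mul hz hβ)) ((𝓟).inv (aeval_mem_adjoinRootPlace b) hb')⟩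

include h hp in
/-- If one of the coordinates of `K` vanishes at the place, then its residue field is a field of
rational functions. -/
lemma exists_adjoin_simple_eq_top [IsAlgClosed k] {x y : K} (hxy : IsCoord k x y)
    (hx : (x, (0 : AdjoinRoot p)) ∈ (𝓟).graph) :
    ∃ t : AdjoinRoot p, Transcendental k t ∧ k⟮t⟯ = ⊤ := by
  obtain ⟨D₁, h1u, h1w⟩ := h.exists_derivation 1 0
  obtain ⟨D₂, h2u, h2w⟩ := h.exists_derivation 0 1
  have hpw : aeval w p ≠ 0 := fun h0 => hp.out.ne_zero (transcendental_iff.1 hw p h0)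
  have hD₁ : ∀ {z ω}, (z, ω) ∈ (𝓟).graph → ∃ ω', (D₁ z, ω') ∈ (𝓟).graph := fun hz =>
    derivation_mem_adjoinRootPlace D₁ ⟨1, h1u ▸ (𝓟).one⟩ ⟨0, h1w ▸ (𝓟).zero⟩ hz
  have hD₂ : ∀ {z ω}, (z, ω) ∈ (𝓟).graph → ∃ ω', (D₂ z, ω') ∈ (𝓟).graph := fun hz =>
    derivation_mem_adjoinRootPlace D₂ ⟨0, h2u ▸ (𝓟).zero⟩ ⟨1, h2w ▸ (𝓟).one⟩ hz
  let J : K → K → K := fun x y => D₁ x * D₂ y - D₂ x * D₁ y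
  have hJdiv : ∀ x y, x ≠ 0 → J x (y / x) = J x y / x := by
    intro x y hx
    simp only [J, Derivation.apply_div _ _ hx]
    field_simp
    ring
  have hJstep : ∀ {x z : K} {n : ℕ}, (x, (0 : AdjoinRoot p)) ∈ (𝓟).graph → x ≠ 0 →
      (∀ ω, (z / aeval w p ^ (n + 1), ω) ∉ (𝓟).graph) →
      ∀ ω, (z / x / aeval w p ^ n, ω) ∉ (𝓟).graph := by
    intro x z n hx hx0 hz ω hω
    obtain ⟨z', ω', hz', hxz'⟩ := exists_eq_mul_of_mem_adjoinRootPlace hx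
    have hmul := (𝓟).mul hω hz'
    have e : z / x / aeval w p ^ n * z' = z / aeval w p ^ (n + 1) := by
      have hz0 : z' ≠ 0 := by rintro rfl; exact hx0 (by rw [hxz', mul_zero])
      rw [hxz']
      field_simp
      ring
    rw [e] at hmul
    exact hz _ hmul
  have key : ∀ n : ℕ, ∀ x y η, IsCoord k x y → (x, (0 : AdjoinRoot p)) ∈ (𝓟).graph →
      (y, η) ∈ (𝓟).graph → (∀ ω, (J x y / aeval w p ^ n, ω) ∉ (𝓟).graph) →
      ∃ t : AdjoinRoot p, Transcendental k t ∧ k⟮t⟯ = ⊤ := by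
    intro n
    induction n with
    | zero =>
      intro x y η _ hx hy hJ
      obtain ⟨_, h1⟩ := hD₁ hx
      obtain ⟨_, h2⟩ := hD₂ hx
      obtain ⟨_, h3⟩ := hD₁ hy
      obtain ⟨_, h4⟩ := hD₂ hy
      refine absurd ((𝓟).sub ((𝓟).mul h1 h4) ((𝓟).mul h2 h3)) ?_
      simpa [J] using hJ _
    | succ n ih =>
      intro x y η hxy hx hy hJ
      by_cases hη : IsAlgebraic k η
      · obtain ⟨c, rfl⟩ := exists_algebraMap_eq_of_isAlgebraic hη
        have hxy' := hxy.sub_algebraMap c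
        have hy' := (𝓟).sub hy ((𝓟).algebraMap c)
        have hJ' : J x y = J x (y - algebraMap k K c) := by simp [J]
        rw [hJ'] at hJ
        rw [sub_self] at hy'
        generalize y - algebraMap k K c = y' at *
        rcases (𝓟).total (y' / x) with ⟨ω, hω⟩ | h0
        · refine ih x (y' / x) ω hxy'.div_snd hx hω ?_
          rw [hJdiv x y' hxy'.fst_ne_zero]
          exact hJstep hx hxy'.fst_ne_zero hJ
        · rw [inv_div] at h0
          refine ih y' (x / y') 0 hxy'.symm.div_snd hy' h0 ?_
          rw [hJdiv y' x hxy'.snd_ne_zero]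
          refine hJstep hy' hxy'.snd_ne_zero fun ω hω => hJ (-ω) ?_
          have := (𝓟).neg hω
          rwa [← neg_div, show -J y' x = J x y' by simp only [J]; ring] at this
      · refine ⟨η, hη, top_le_iff.1 fun ω _ => ?_⟩
        obtain ⟨a, rfl⟩ := AdjoinRoot.mk_surjective ω
        exact (𝓟).mem_adjoin_of_transcendental hxy hx hy hη (aeval_mem_adjoinRootPlace a)
  have hstart : ∀ x y η, IsCoord k x y → (x, (0 : AdjoinRoot p)) ∈ (𝓟).graph →
      (y, η) ∈ (𝓟).graph → ∃ t : AdjoinRoot p, Transcendental k t ∧ k⟮t⟯ = ⊤ := by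
    intro x y η hxy hx hy
    obtain ⟨n, hn⟩ := exists_not_mem_adjoinRootPlace (p := p) (hw := hw) (htop := htop)
      (hxy.jacobian_ne_zero h1u h1w h2u h2w)
    exact key n x y η hxy hx hy hn
  rcases (𝓟).total y with ⟨η, hη⟩ | h0
  · exact hstart x y η hxy hx hη
  · exact hstart x y⁻¹ 0 hxy.symm.inv_fst.symm hx h0

end RuledResidueField

section Residue

open IntermediateField Polynomial

variable {k Ω : Type*} [Field k] [Field Ω] [Algebra k Ω]

lemma isAlgebraic_of_sq_eq_fibreProd [IsAlgClosed k] (h2 : (2 : k) ≠ 0) {I : Finset k}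
    (hI : ∀ a ∈ I, a ≠ 2 ∧ a ≠ -2) (hne : I.Nonempty) (e : Ω ≃ₐ[k] RatFunc k) {x r : Ω}
    (h : r ^ 2 = fibreProd I x) : IsAlgebraic k x := by
  obtain ⟨c, hc⟩ := ratFunc_eq_C_of_sq_eq_fibreProd h2 hI hne (u := e x) (w := e r)
    (by rw [← map_pow, h]; exact map_fibreProd e.toAlgHom I x)
  have : x = algebraMap k Ω c := by
    apply e.injective
    rw [hc, AlgEquiv.commutes]
    rfl
  exact this ▸ isAlgebraic_algebraMap c

lemma adjoin_simple_ne_top_of_sq_eq_fibreProd [IsAlgClosed k] (h2 : (2 : k) ≠ 0) {I : Finset k}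
    (hI : ∀ a ∈ I, a ≠ 2 ∧ a ≠ -2) (hne : I.Nonempty) {x r : Ω} (hx : Transcendental k x)
    (h : r ^ 2 = fibreProd I x) {t : Ω} (ht : Transcendental k t) : k⟮t⟯ ≠ ⊤ := by
  intro htop
  refine hx (isAlgebraic_of_sq_eq_fibreProd h2 hI hne ?_ h)
  exact ((RatFunc.algEquivOfTranscendental t ht).trans
    ((equivOfEq htop).trans topEquiv)).symm

lemma irreducible_sq_sub_fibreProd [IsAlgClosed k] (h2 : (2 : k) ≠ 0) {I : Finset k}
    (hI : ∀ a ∈ I, a ≠ 2 ∧ a ≠ -2) (hne : I.Nonempty) {u : Ω} (hu : Transcendental k u) :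
    Irreducible (X ^ 2 - C (fibreProd I (AdjoinSimple.gen k u)) : k⟮u⟯[X]) := by
  refine X_pow_sub_C_irreducible_of_prime Nat.prime_two fun r hr => ?_
  refine hu ?_
  have := isAlgebraic_of_sq_eq_fibreProd h2 hI hne
    (RatFunc.algEquivOfTranscendental u hu).symm (r := r) hr
  exact (isAlgebraic_algebraMap_iff (algebraMap k⟮u⟯ Ω).injective).2 this

lemma mem_of_mem_placeGraph {E K : Type*} [Field E] [Field K] [Algebra E K]
    [Algebra k K] (P : Place k K Ω) {w : K}
    (hw : Transcendental E w) (htop : E⟮w⟯ = ⊤) (F : IntermediateField k Ω)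
    (hE : ∀ e : E, ∃ ω ∈ F, (algebraMap E K e, ω) ∈ P.graph) (hwP : ∃ ω ∈ F, (w, ω) ∈ P.graph)
    {z : K} {ω : Ω} (hz : (z, ω) ∈ P.graph) : ω ∈ F := by
  obtain ⟨r, hrF, hr⟩ := hwP
  have hev : ∀ q : E[X], ∃ ω ∈ F, (aeval w q, ω) ∈ P.graph := by
    intro q
    induction q using Polynomial.induction_on' with
    | add p q hp hq =>
      obtain ⟨α, hαF, hα⟩ := hp
      obtain ⟨β, hβF, hβ⟩ := hq
      exact ⟨α + β, add_mem hαF hβF, by rw [map_add]; exact P.add hα hβ⟩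
    | monomial n a =>
      obtain ⟨α, hαF, hα⟩ := hE a
      exact ⟨α * r ^ n, mul_mem hαF (pow_mem hrF n), by
        rw [aeval_monomial]; exact P.mul hα (P.pow hr n)⟩
  obtain ⟨a, b, hab, hb, h⟩ := exists_aeval_eq_of_adjoin_eq_top hw htop z
  obtain ⟨α, hαF, hα⟩ := hev a
  obtain ⟨β, hβF, hβ⟩ := hev b
  have hαβ : ω * β = α := P.unique (h ▸ P.mul hz hβ) hα
  by_cases hβ0 : β = 0
  · obtain ⟨c, d, hcd⟩ := hab
    obtain ⟨γ, -, hγ⟩ := hev c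
    obtain ⟨δ, -, hδ⟩ := hev d
    have h1 := P.add (P.mul hγ hα) (P.mul hδ hβ)
    rw [← map_mul, ← map_mul, ← map_add, hcd, map_one] at h1
    have := P.unique P.one h1
    simp [← hαβ, hβ0] at this
  · rw [eq_div_of_mul_eq hβ0 hαβ]
    exact div_mem hαF hβF

lemma Transcendental.ne_zero' {x : Ω} (h : Transcendental k x) : x ≠ 0 :=
  fun h0 => h (h0 ▸ isAlgebraic_zero)

/-- The place of `K` along the fixed curve `w² = P(u)` of the involution `w ↦ P(u) / w`. -/
structure IsFixedCurve {K : Type*} [Field K] [Algebra k K] (I : Finset k) (u w : K)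
    (P : Place k K Ω) (x r : Ω) : Prop where
  fst : (u, x) ∈ P.graph
  snd : (w, r) ∈ P.graph
  transcendental : Transcendental k x
  sq_eq : r ^ 2 = fibreProd I x
  adjoin_eq_top : adjoin k {x, r} = ⊤
  surjective : ∀ ω, ∃ z, (z, ω) ∈ P.graph
  not_mem : ∀ x' y', IsCoord k x' y' → (x', 0) ∉ P.graph
  equivariant : ∀ g ∈ coordGroup k I u w, ∃ γ : Ω →ₐ[k] Ω,
    ∀ z ω, (z, ω) ∈ P.graph → (g z, γ ω) ∈ P.graph

lemma IsCoord.exists_isFixedCurve {K : Type*} [Field K] [Algebra k K] [IsAlgClosed k]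
    (h2 : (2 : k) ≠ 0) {I : Finset k} (hI : ∀ a ∈ I, a ≠ 2 ∧ a ≠ -2) (hne : I.Nonempty) {u w : K}
    (h : IsCoord k u w) : ∃ (E : IntermediateField k K) (p : E[X]) (_ : Fact (Irreducible p))
      (P : Place k K (AdjoinRoot p)) (x r : AdjoinRoot p), IsFixedCurve I u w P x r := by
  have hu := h.transcendental_fst
  let f : k⟮u⟯ := fibreProd I (AdjoinSimple.gen k u)
  have hf : algebraMap k⟮u⟯ K f = fibreProd I u := map_fibreProd k⟮u⟯.val I _
  have hp : Fact (Irreducible (X ^ 2 - C f)) := ⟨irreducible_sq_sub_fibreProd h2 hI hne hu⟩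
  let P := adjoinRootPlace k (X ^ 2 - C f) w h.transcendental_snd h.adjoin_snd
  let ι : k⟮u⟯ →ₐ[k] AdjoinRoot (X ^ 2 - C f) := IsScalarTower.toAlgHom k _ _
  have hι : ∀ e, (algebraMap k⟮u⟯ K e, ι e) ∈ P.graph := algebraMap_mem_adjoinRootPlace
  let x := ι (AdjoinSimple.gen k u)
  let r := AdjoinRoot.root (X ^ 2 - C f)
  have hux : (u, x) ∈ P.graph := hι (AdjoinSimple.gen k u)
  have hwr : (w, r) ∈ P.graph := root_mem_adjoinRootPlace
  have hx : Transcendental k x := by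
    intro halg
    rw [isAlgebraic_algHom_iff ι ι.injective] at halg
    exact hu ((isAlgebraic_algHom_iff k⟮u⟯.val k⟮u⟯.val.injective).2 halg)
  have hr : r ^ 2 = fibreProd I x := by
    have : AdjoinRoot.mk (X ^ 2 - C f) (X ^ 2 - C f) = 0 := AdjoinRoot.mk_self
    rw [map_sub, map_pow, AdjoinRoot.mk_X, AdjoinRoot.mk_C, sub_eq_zero] at this
    exact this.trans (map_fibreProd ι I _)
  have hr0 : r ≠ 0 := by
    intro h0
    rw [h0] at hr
    exact fibreProd_ne_zero I hx (by rw [← hr]; simp)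
  have hsurj : ∀ ω, ∃ z, (z, ω) ∈ P.graph := by
    intro ω
    obtain ⟨a, rfl⟩ := AdjoinRoot.mk_surjective ω
    exact ⟨_, aeval_mem_adjoinRootPlace a⟩
  have hE : ∀ e ∈ k⟮u⟯, ∃ ω ∈ adjoin k {x, r}, (e, ω) ∈ P.graph := fun e he =>
    (P.exists_value_of_mem_adjoin hux hx he).imp
      fun _ hω => ⟨adjoin.mono _ _ _ (by simp) hω.1, hω.2⟩
  refine ⟨k⟮u⟯, X ^ 2 - C f, hp, P, x, r, ⟨hux, hwr, hx, hr, ?_, hsurj, ?_, ?_⟩⟩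
  · refine top_le_iff.1 fun ω _ => ?_
    obtain ⟨z, hz⟩ := hsurj ω
    exact mem_of_mem_placeGraph P h.transcendental_snd h.adjoin_snd _ (fun e => hE e e.2)
      ⟨r, subset_adjoin _ _ (by simp), hwr⟩ hz
  · intro x' y' hxy hx'
    obtain ⟨t, ht, htop⟩ := exists_adjoin_simple_eq_top h hxy hx'
    exact adjoin_simple_ne_top_of_sq_eq_fibreProd h2 hI hne hx hr ht htop
  · intro g hg
    have hgw : ∃ ρ, (g w, ρ) ∈ P.graph ∧ ρ ^ 2 = fibreProd I x := by
      have hq : (fibreProd I u * w⁻¹, r) ∈ P.graph := by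
        have := P.mul (P.fibreProd hux hx.ne_zero' I) (P.inv hwr hr0)
        have e : fibreProd I x * r⁻¹ = r := hr ▸ by field_simp
        rwa [e] at this
      rcases apply_snd_of_mem_coordGroup h hg with e | e | e | e <;> rw [e]
      · exact ⟨r, hwr, hr⟩
      · exact ⟨-r, P.neg hwr, by rw [neg_sq, hr]⟩
      · exact ⟨r, hq, hr⟩
      · exact ⟨-r, P.neg hq, by rw [neg_sq, hr]⟩
    obtain ⟨ρ, hρ, hρ2⟩ := hgw
    have hgu : g u ∈ k⟮u⟯ := by
      have := mem_adjoin_simple_self k u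
      rcases apply_fst_of_mem_coordGroup h hg with e | e | e | e <;> rw [e]
      · exact this
      · exact neg_mem this
      · exact inv_mem this
      · exact neg_mem (inv_mem this)
    have hge : ∀ e ∈ k⟮u⟯, g e ∈ k⟮u⟯ := by
      intro e he
      have : k⟮u⟯ ≤ k⟮u⟯.comap g.toAlgHom := adjoin_simple_le_iff.2 hgu
      exact this he
    obtain ⟨γ, hγ⟩ := exists_algHom_of_place (p := X ^ 2 - C f) h.transcendental_snd h.adjoin_snd
      (P.comap g) (fun e => (hE _ (hge e e.2)).imp fun _ h => h.2) ⟨ρ, hρ⟩ (by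
        rw [Place.mem_comap]
        have := P.sub (P.pow hρ 2) (P.fibreProd hux hx.ne_zero' I)
        rw [hρ2, sub_self] at this
        rw [map_sub, map_pow, aeval_X, aeval_C, hf, map_sub, map_pow,
          map_fibreProd_of_mem_coordGroup h hg]
        exact this)
    exact ⟨γ, fun z ω hz => hγ z ω hz⟩

end Residue

section QuadraticTower

open IntermediateField

variable {k Ω : Type*} [Field k] [Field Ω] [Algebra k Ω]

/-- The intermediate field `F(d)`, for `d` a square root of an element of `F`. -/
def quadExt (F : IntermediateField k Ω) (d : Ω) (hd : d ^ 2 ∈ F) : IntermediateField k Ω where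
  carrier := {z | ∃ a ∈ F, ∃ b ∈ F, z = a + b * d}
  mul_mem' := by
    rintro _ _ ⟨a, ha, b, hb, rfl⟩ ⟨a', ha', b', hb', rfl⟩
    exact ⟨a * a' + b * b' * d ^ 2, add_mem (mul_mem ha ha') (mul_mem (mul_mem hb hb') hd),
      a * b' + b * a', add_mem (mul_mem ha hb') (mul_mem hb ha'), by ring⟩
  add_mem' := by
    rintro _ _ ⟨a, ha, b, hb, rfl⟩ ⟨a', ha', b', hb', rfl⟩
    exact ⟨a + a', add_mem ha ha', b + b', add_mem hb hb', by ring⟩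
  algebraMap_mem' c := ⟨_, F.algebraMap_mem c, 0, zero_mem F, by simp⟩
  inv_mem' := by
    rintro _ ⟨a, ha, b, hb, rfl⟩
    by_cases hdF : d ∈ F
    · exact ⟨_, inv_mem (add_mem ha (mul_mem hb hdF)), 0, zero_mem F, by simp⟩
    have hn : a ^ 2 - b ^ 2 * d ^ 2 ∈ F :=
      sub_mem (pow_mem ha 2) (mul_mem (pow_mem hb 2) hd)
    by_cases hb0 : b = 0
    · exact ⟨a⁻¹, inv_mem ha, 0, zero_mem F, by simp [hb0]⟩
    have h1 : a + b * d ≠ 0 := fun h => hdF (by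
      have : d = -a / b := by rw [eq_div_iff hb0]; linear_combination h
      exact this ▸ div_mem (neg_mem ha) hb)
    have h2 : a - b * d ≠ 0 := fun h => hdF (by
      have : d = a / b := by rw [eq_div_iff hb0]; linear_combination -h
      exact this ▸ div_mem ha hb)
    refine ⟨a / (a ^ 2 - b ^ 2 * d ^ 2), div_mem ha hn, -b / (a ^ 2 - b ^ 2 * d ^ 2),
      div_mem (neg_mem hb) hn, ?_⟩
    have e : a ^ 2 - b ^ 2 * d ^ 2 = (a + b * d) * (a - b * d) := by ring
    rw [e]
    field_simp
    ring

variable {F : IntermediateField k Ω} {d : Ω}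

lemma le_quadExt (hd : d ^ 2 ∈ F) : F ≤ quadExt F d hd :=
  fun a ha => ⟨a, ha, 0, zero_mem F, by simp⟩

lemma mem_quadExt_self (hd : d ^ 2 ∈ F) : d ∈ quadExt F d hd :=
  ⟨0, zero_mem F, 1, one_mem F, by simp⟩

lemma mem_of_mem_quadExt (h2 : (2 : Ω) ≠ 0) (hd : d ^ 2 ∈ F) (γ : Ω →ₐ[k] Ω)
    (hγF : ∀ z ∈ F, γ z = z) (hγd : γ d = -d) {z : Ω} (hz : z ∈ quadExt F d hd) (hγz : γ z = z) :
    z ∈ F := by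
  obtain ⟨a, ha, b, hb, rfl⟩ := hz
  rw [map_add, map_mul, hγF a ha, hγF b hb, hγd] at hγz
  have : b * d = 0 := by
    have : 2 * (b * d) = 0 := by linear_combination -hγz
    exact (mul_eq_zero.1 this).resolve_left h2
  rwa [this, add_zero]

lemma apply_eq_of_mem_quadExt (hd : d ^ 2 ∈ F) (γ : Ω →ₐ[k] Ω)
    (hγF : ∀ z ∈ F, γ z = z) (hγd : γ d = d) : ∀ z ∈ quadExt F d hd, γ z = z := by
  rintro _ ⟨a, ha, b, hb, rfl⟩
  rw [map_add, map_mul, hγF a ha, hγF b hb, hγd]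

/-- An element of `F` which becomes a square in `F(d)` is a square in `F` up to a power of `d²`. -/
lemma exists_mul_sq_of_mem_quadExt (h2 : (2 : Ω) ≠ 0) (hd : d ^ 2 ∈ F) {f g : Ω} (hf : f ∈ F)
    (hg : g ∈ quadExt F d hd) (hfg : f = g ^ 2) :
    ∃ e : ℕ, ∃ g' ∈ F, f * (d ^ 2) ^ e = g' ^ 2 := by
  obtain ⟨a, ha, b, hb, rfl⟩ := hg
  by_cases hdF : d ∈ F
  · exact ⟨0, _, add_mem ha (mul_mem hb hdF), by simpa using hfg⟩
  have hab : a * b = 0 := by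
    by_contra hab
    refine hdF ?_
    have : d = (f - a ^ 2 - b ^ 2 * d ^ 2) / (2 * (a * b)) := by
      rw [eq_div_iff (mul_ne_zero h2 hab), hfg]
      ring
    rw [this]
    exact div_mem (sub_mem (sub_mem hf (pow_mem ha 2)) (mul_mem (pow_mem hb 2) hd))
      (mul_mem (ofNat_mem F 2) (mul_mem ha hb))
  rcases mul_eq_zero.1 hab with h0 | h0
  · exact ⟨1, b * d ^ 2, mul_mem hb hd, by rw [hfg, h0]; ring⟩
  · exact ⟨0, a, ha, by rw [hfg, h0]; ring⟩

variable {x r : Ω} {I : Finset k}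

lemma fibreProd_mem_adjoin : fibreProd I x ∈ k⟮x ^ 2 + (x ^ 2)⁻¹⟯ :=
  prod_mem fun a _ => sub_mem (mem_adjoin_simple_self k _) (IntermediateField.algebraMap_mem _ a)

lemma add_inv_sq_mem_adjoin (hx : x ≠ 0) : (x + x⁻¹) ^ 2 ∈ k⟮x ^ 2 + (x ^ 2)⁻¹⟯ := by
  have : (x + x⁻¹) ^ 2 = x ^ 2 + (x ^ 2)⁻¹ + 2 := by field_simp; ring
  exact this ▸ add_mem (mem_adjoin_simple_self k _) (ofNat_mem _ 2)

lemma sub_inv_sq_mem_adjoin (hx : x ≠ 0) : (x - x⁻¹) ^ 2 ∈ k⟮x ^ 2 + (x ^ 2)⁻¹⟯ := by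
  have : (x - x⁻¹) ^ 2 = x ^ 2 + (x ^ 2)⁻¹ - 2 := by field_simp; ring
  exact this ▸ sub_mem (mem_adjoin_simple_self k _) (ofNat_mem _ 2)

/-- The first step of the quadratic tower `k(t) ⊆ k(x, r)`, where `t = x² + x⁻²`. -/
def towerOne (k : Type*) [Field k] [Algebra k Ω] {x : Ω} (hx : x ≠ 0) : IntermediateField k Ω :=
  quadExt k⟮x ^ 2 + (x ^ 2)⁻¹⟯ (x + x⁻¹) (add_inv_sq_mem_adjoin hx)

/-- The second step of the quadratic tower `k(t) ⊆ k(x, r)`, where `t = x² + x⁻²`. -/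
def towerTwo (k : Type*) [Field k] [Algebra k Ω] {x : Ω} (hx : x ≠ 0) : IntermediateField k Ω :=
  quadExt (towerOne k hx) (x - x⁻¹) (le_quadExt _ (sub_inv_sq_mem_adjoin hx))

lemma adjoin_le_towerOne (hx : x ≠ 0) : k⟮x ^ 2 + (x ^ 2)⁻¹⟯ ≤ towerOne k hx := le_quadExt _

lemma towerOne_le_towerTwo (hx : x ≠ 0) : towerOne k hx ≤ towerTwo k hx := le_quadExt _

lemma sq_mem_towerTwo (hx : x ≠ 0) (hr : r ^ 2 = fibreProd I x) : r ^ 2 ∈ towerTwo k hx :=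
  towerOne_le_towerTwo hx (adjoin_le_towerOne hx (hr ▸ fibreProd_mem_adjoin))

lemma quadExt_towerTwo_eq_top (h2 : (2 : Ω) ≠ 0) (hx : x ≠ 0) (hr : r ^ 2 = fibreProd I x)
    (htop : adjoin k {x, r} = ⊤) :
    quadExt (towerTwo k hx) r (sq_mem_towerTwo hx hr) = ⊤ := by
  rw [← top_le_iff, ← htop, adjoin_le_iff]
  rintro z (rfl | rfl)
  · refine le_quadExt _ ?_
    have h : z = ((z + z⁻¹) + (z - z⁻¹)) / 2 := by field_simp; ring
    have h1 : z + z⁻¹ ∈ towerTwo k hx := towerOne_le_towerTwo hx (mem_quadExt_self _)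
    have h3 : z - z⁻¹ ∈ towerTwo k hx := mem_quadExt_self _
    have hz := div_mem (add_mem h1 h3) (ofNat_mem (towerTwo k hx) 2)
    rwa [← h] at hz
  · exact mem_quadExt_self _

/-- The elements of `k(x, r)` fixed by `x ↦ -x`, `x ↦ x⁻¹` and `r ↦ -r` lie in `k(x² + x⁻²)`. -/
lemma mem_adjoin_of_fixed (h2 : (2 : Ω) ≠ 0) (hx : x ≠ 0) (hr : r ^ 2 = fibreProd I x)
    (htop : adjoin k {x, r} = ⊤) {γ₁ γ₂ γ₃ : Ω →ₐ[k] Ω} (h₁ : γ₁ x = -x) (h₂ : γ₂ x = x⁻¹)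
    (h₃ : γ₃ x = x) (h₃' : γ₃ r = -r) {s : Ω} (hs₁ : γ₁ s = s) (hs₂ : γ₂ s = s) (hs₃ : γ₃ s = s) :
    s ∈ k⟮x ^ 2 + (x ^ 2)⁻¹⟯ := by
  have hbase : ∀ γ : Ω →ₐ[k] Ω, γ (x ^ 2 + (x ^ 2)⁻¹) = x ^ 2 + (x ^ 2)⁻¹ →
      ∀ z ∈ k⟮x ^ 2 + (x ^ 2)⁻¹⟯, γ z = z := by
    intro γ hγ z hz
    induction hz using IntermediateField.adjoin_induction with
    | mem z hz => rw [Set.mem_singleton_iff.1 hz, hγ]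
    | algebraMap a => simp
    | add a b _ _ ha hb => rw [map_add, ha, hb]
    | inv a _ ha => rw [map_inv₀, ha]
    | mul a b _ _ ha hb => rw [map_mul, ha, hb]
  have hs3 : s ∈ towerTwo k hx := by
    refine mem_of_mem_quadExt h2 (sq_mem_towerTwo hx hr) γ₃ ?_ h₃'
      (quadExt_towerTwo_eq_top h2 hx hr htop ▸ mem_top) hs₃
    exact apply_eq_of_mem_quadExt _ γ₃ (apply_eq_of_mem_quadExt _ γ₃ (hbase γ₃ (by simp [h₃]))
      (by simp [h₃])) (by simp [h₃])
  have hs2 : s ∈ towerOne k hx :=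
    mem_of_mem_quadExt h2 _ γ₂ (apply_eq_of_mem_quadExt _ γ₂ (hbase γ₂ (by simp [h₂, add_comm]))
      (by simp [h₂, add_comm])) (by simp [h₂]) hs3 hs₂
  exact mem_of_mem_quadExt h2 _ γ₁ (hbase γ₁ (by simp [h₁])) (by simp [h₁, add_comm]) hs2 hs₁

/-- Kummer theory for the field `k(x, r)` over `k(t)`, where `t = x² + x⁻²`. -/
lemma exists_mul_eq_sq (h2 : (2 : Ω) ≠ 0) (hx : x ≠ 0) (hr : r ^ 2 = fibreProd I x)
    (htop : adjoin k {x, r} = ⊤) {f g : Ω} (hf : f ∈ k⟮x ^ 2 + (x ^ 2)⁻¹⟯) (hfg : f = g ^ 2) :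
    ∃ e₁ e₂ e₃ : ℕ, ∃ g' ∈ k⟮x ^ 2 + (x ^ 2)⁻¹⟯,
      f * fibreProd I x ^ e₃ * (x ^ 2 + (x ^ 2)⁻¹ - 2) ^ e₂ * (x ^ 2 + (x ^ 2)⁻¹ + 2) ^ e₁ =
        g' ^ 2 := by
  have h1 : (x + x⁻¹) ^ 2 = x ^ 2 + (x ^ 2)⁻¹ + 2 := by field_simp; ring
  have h3 : (x - x⁻¹) ^ 2 = x ^ 2 + (x ^ 2)⁻¹ - 2 := by field_simp; ring
  obtain ⟨e₃, g₃, hg₃, hf₃⟩ := exists_mul_sq_of_mem_quadExt h2 (sq_mem_towerTwo hx hr)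
    (towerOne_le_towerTwo hx (adjoin_le_towerOne hx hf))
    (quadExt_towerTwo_eq_top h2 hx hr htop ▸ mem_top (x := g)) hfg
  rw [hr] at hf₃
  have hm : f * fibreProd I x ^ e₃ ∈ k⟮x ^ 2 + (x ^ 2)⁻¹⟯ :=
    mul_mem hf (pow_mem fibreProd_mem_adjoin _)
  obtain ⟨e₂, g₂, hg₂, hf₂⟩ := exists_mul_sq_of_mem_quadExt h2 _
    (adjoin_le_towerOne hx hm) hg₃ hf₃
  obtain ⟨e₁, g₁, hg₁, hf₁⟩ := exists_mul_sq_of_mem_quadExt h2 _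
    (mul_mem hm (pow_mem (sub_inv_sq_mem_adjoin hx) _)) hg₂ hf₂
  rw [h1, h3] at hf₁
  exact ⟨e₁, e₂, e₃, g₁, hg₁, hf₁⟩

end QuadraticTower

section CompareCurves

open IntermediateField

variable {k K Ω : Type*} [Field k] [Field K] [Field Ω] [Algebra k K] [Algebra k Ω]
  {I J : Finset k} {u w a b : K} {P : Place k K Ω} {x r : Ω}

lemma IsCoord.exists_mem_coordGroup (h : IsCoord k u w) (I : Finset k) :
    (∃ σ ∈ coordGroup k I u w, σ u = -u ∧ σ w = w) ∧
    (∃ σ ∈ coordGroup k I u w, σ u = u⁻¹ ∧ σ w = w) ∧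
    (∃ σ ∈ coordGroup k I u w, σ u = u ∧ σ w = -w) ∧
    (∃ σ ∈ coordGroup k I u w, σ u = u ∧ σ w = fibreProd I u * w⁻¹) := by
  have hP := fibreProd_ne_zero I h.transcendental_fst
  obtain ⟨σ₁, h₁⟩ := h.exists_algEquiv h.neg_fst
  obtain ⟨σ₂, h₂⟩ := h.exists_algEquiv h.inv_fst
  obtain ⟨σ₃, h₃⟩ := h.exists_algEquiv h.symm.neg_fst.symm
  obtain ⟨σ₄, h₄⟩ := h.exists_algEquiv (h.symm.inv_fst.symm.mul_snd
    (fibreProd_mem I (mem_adjoin_simple_self k u)) hP)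
  exact ⟨⟨σ₁, Subgroup.subset_closure (Or.inl h₁), h₁⟩,
    ⟨σ₂, Subgroup.subset_closure (Or.inr (Or.inl h₂)), h₂⟩,
    ⟨σ₃, Subgroup.subset_closure (Or.inr (Or.inr (Or.inl h₃))), h₃⟩,
    ⟨σ₄, Subgroup.subset_closure (Or.inr (Or.inr (Or.inr h₄))), h₄⟩⟩

namespace IsFixedCurve

lemma exists_value [IsAlgClosed k] (hC : IsFixedCurve I u w P x r) (h : IsCoord k a b) :
    ∃ ξ, (a, ξ) ∈ P.graph ∧ Transcendental k ξ := by
  rcases P.total a with ⟨ξ, hξ⟩ | h0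
  · refine ⟨ξ, hξ, fun halg => ?_⟩
    obtain ⟨c, rfl⟩ := exists_algebraMap_eq_of_isAlgebraic halg
    refine hC.not_mem _ _ (h.symm.sub_algebraMap c).symm ?_
    have := P.sub hξ (P.algebraMap c)
    rwa [sub_self] at this
  · exact absurd h0 (hC.not_mem _ _ h.inv_fst)

end IsFixedCurve

/-- The values of the invariant functions along a curve lie in `k(x² + x⁻²)`. -/
lemma mem_adjoin_of_invariant (h2 : (2 : Ω) ≠ 0) (h : IsCoord k a b)
    (hequiv : ∀ g ∈ coordGroup k J a b, ∃ γ : Ω →ₐ[k] Ω, ∀ z ω, (z, ω) ∈ P.graph →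
      (g z, γ ω) ∈ P.graph) {ξ η : Ω} (hξ : (a, ξ) ∈ P.graph)
    (hη : (b, η) ∈ P.graph) (hξ0 : ξ ≠ 0) (hsq : η ^ 2 = fibreProd J ξ)
    (htop : adjoin k {ξ, η} = ⊤) {v : K} {s : Ω} (hv : ∀ g ∈ coordGroup k J a b, g v = v)
    (hs : (v, s) ∈ P.graph) : s ∈ k⟮ξ ^ 2 + (ξ ^ 2)⁻¹⟯ := by
  obtain ⟨⟨g₁, hg₁, h₁, h₁'⟩, ⟨g₂, hg₂, h₂, h₂'⟩, ⟨g₃, hg₃, h₃, h₃'⟩, -⟩ :=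
    h.exists_mem_coordGroup J
  obtain ⟨γ₁, hγ₁⟩ := hequiv g₁ hg₁
  obtain ⟨γ₂, hγ₂⟩ := hequiv g₂ hg₂
  obtain ⟨γ₃, hγ₃⟩ := hequiv g₃ hg₃
  exact mem_adjoin_of_fixed h2 hξ0 hsq htop (γ₁ := γ₁) (γ₂ := γ₂) (γ₃ := γ₃)
    (P.unique (h₁ ▸ hγ₁ _ _ hξ) (P.neg hξ)) (P.unique (h₂ ▸ hγ₂ _ _ hξ) (P.inv hξ hξ0))
    (P.unique (h₃ ▸ hγ₃ _ _ hξ) hξ) (P.unique (h₃' ▸ hγ₃ _ _ hη) (P.neg hη))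
    (P.unique (hv g₁ hg₁ ▸ hγ₁ _ _ hs) hs) (P.unique (hv g₂ hg₂ ▸ hγ₂ _ _ hs) hs)
    (P.unique (hv g₃ hg₃ ▸ hγ₃ _ _ hs) hs)

lemma IsCoord.coordGroup_mul_algebraMap (h : IsCoord k a b) (J : Finset k) {c : k}
    (hc : c ^ 2 = 1 ∨ c ^ 2 = -1) :
    coordGroup k J a (algebraMap k K c * b) = coordGroup k J a b := by
  have hc0 : c ≠ 0 := by rintro rfl; simp at hc
  have h' : IsCoord k a (algebraMap k K c * b) :=
    h.mul_snd (IntermediateField.algebraMap_mem _ c) (by simpa using hc0)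
  ext σ
  rw [mem_coordGroup_iff h', mem_coordGroup_iff h]
  have hcK : algebraMap k K c ^ 2 = 1 ∨ algebraMap k K c ^ 2 = -1 := by
    rcases hc with hc | hc
    · left; rw [← map_pow, hc, map_one]
    · right; rw [← map_pow, hc, map_neg, map_one]
  rcases hcK with hc | hc
  · rw [mul_pow, hc, one_mul]
  · have : (algebraMap k K c * b) ^ 2 + fibreProd J a ^ 2 * ((algebraMap k K c * b) ^ 2)⁻¹ =
        -(b ^ 2 + fibreProd J a ^ 2 * (b ^ 2)⁻¹) := by
      rw [mul_pow, hc, neg_one_mul, inv_neg]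
      ring
    rw [this, map_neg, neg_inj]

lemma IsCoord.algebraMap_mul_snd (h : IsCoord k a b) {c : k} (hc : c ≠ 0) :
    IsCoord k a (algebraMap k K c * b) :=
  h.mul_snd (IntermediateField.algebraMap_mem _ c) (by simpa using hc)

lemma Transcendental.two_ne_zero_and {ξ : Ω} (hξ : Transcendental k ξ) (h2 : (2 : k) ≠ 0) :
    ξ ≠ -ξ ∧ ξ ≠ ξ⁻¹ ∧ ξ ≠ -ξ⁻¹ := by
  have h2Ω : (2 : Ω) ≠ 0 := by
    rw [← map_ofNat (algebraMap k Ω)]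
    exact (map_ne_zero _).2 h2
  have hξ0 := hξ.ne_zero'
  have key : ∀ c : k, ξ ^ 2 ≠ algebraMap k Ω c := fun c =>
    (hξ.pow two_pos).ne_algebraMap c
  refine ⟨fun h => ?_, fun h => key 1 ?_, fun h => key (-1) ?_⟩
  · have : 2 * ξ = 0 := by linear_combination h
    exact (mul_ne_zero h2Ω hξ0) this
  · rw [map_one, sq]
    nth_rewrite 1 [h]
    exact inv_mul_cancel₀ hξ0
  · rw [map_neg, map_one, sq]
    nth_rewrite 1 [h]
    rw [neg_mul, inv_mul_cancel₀ hξ0]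

/-- The fixed curve of `w ↦ P_I(u) / w` in the coordinates `a, b` defining the same group. -/
lemma IsFixedCurve.exists_second_model [IsAlgClosed k] (h2 : (2 : k) ≠ 0)
    (hC : IsFixedCurve I u w P x r) (huw : IsCoord k u w) (hab : IsCoord k a b)
    (hG : coordGroup k I u w = coordGroup k J a b) :
    J.Nonempty ∧ ∃ ξ η : Ω, Transcendental k ξ ∧ η ^ 2 = fibreProd J ξ ∧
      adjoin k {ξ, η} = ⊤ ∧ ξ ^ 2 + (ξ ^ 2)⁻¹ ∈ k⟮x ^ 2 + (x ^ 2)⁻¹⟯ ∧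
      x ^ 2 + (x ^ 2)⁻¹ ∈ k⟮ξ ^ 2 + (ξ ^ 2)⁻¹⟯ := by
  have h2Ω : (2 : Ω) ≠ 0 := by
    rw [← map_ofNat (algebraMap k Ω)]
    exact (map_ne_zero _).2 h2
  have hx0 := hC.transcendental.ne_zero'
  have hr0 : r ≠ 0 := fun h0 => fibreProd_ne_zero I hC.transcendental (by
    rw [← hC.sq_eq, h0]; simp)
  obtain ⟨ξ, hξ, hξt⟩ := hC.exists_value hab
  obtain ⟨η, hη, hηt⟩ := hC.exists_value hab.symm
  have hη0 := hηt.ne_zero'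
  obtain ⟨τ, hτ, hτu, hτw⟩ := (huw.exists_mem_coordGroup I).2.2.2
  have hτP : ∀ z ω, (z, ω) ∈ P.graph → (τ z, ω) ∈ P.graph := by
    obtain ⟨γ, hγ⟩ := hC.equivariant τ hτ
    have hγx : γ x = x := P.unique (hτu ▸ hγ _ _ hC.fst) hC.fst
    have hγr : γ r = r := by
      have h1 : (fibreProd I u * w⁻¹, γ r) ∈ P.graph := hτw ▸ hγ _ _ hC.snd
      rw [P.unique h1 (P.mul (P.fibreProd hC.fst hx0 I) (P.inv hC.snd hr0)), ← hC.sq_eq, sq,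
        mul_inv_cancel_right₀ hr0]
    have hγ1 : ∀ ω, γ ω = ω := by
      intro ω
      have hω : ω ∈ adjoin k {x, r} := hC.adjoin_eq_top ▸ mem_top
      induction hω using IntermediateField.adjoin_induction with
      | mem z hz => rcases hz with rfl | rfl <;> assumption
      | algebraMap a => simp
      | add a b _ _ ha hb => rw [map_add, ha, hb]
      | inv a _ ha => rw [map_inv₀, ha]
      | mul a b _ _ ha hb => rw [map_mul, ha, hb]
    intro z ω hz
    simpa [hγ1] using hγ z ω hz
  have hτJ := hG ▸ hτ
  have hne := hξt.two_ne_zero_and h2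
  have hτa : τ a = a := by
    have h1 := hτP _ _ hξ
    rcases apply_fst_of_mem_coordGroup hab hτJ with e | e | e | e
    · exact e
    · exact absurd (P.unique (e ▸ h1) (P.neg hξ)) hne.1
    · exact absurd (P.unique (e ▸ h1) (P.inv hξ hξt.ne_zero')) hne.2.1
    · exact absurd (P.unique (e ▸ h1) (P.neg (P.inv hξ hξt.ne_zero'))) hne.2.2
  have hτb : τ b ≠ b := by
    intro e
    have : τ = AlgEquiv.refl := hab.algEquiv_ext hτa e
    rw [this, AlgEquiv.coe_refl, id] at hτw
    refine huw.transcendental_snd ⟨Polynomial.X ^ 2 -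
      Polynomial.C (fibreProd I (AdjoinSimple.gen k u)), ?_, ?_⟩
    · exact Polynomial.X_pow_sub_C_ne_zero two_pos _
    · have hf : algebraMap k⟮u⟯ K (fibreProd I (AdjoinSimple.gen k u)) = fibreProd I u :=
        map_fibreProd k⟮u⟯.val I _
      have hw2 : w ^ 2 = fibreProd I u := by
        rw [sq]
        nth_rewrite 1 [hτw]
        rw [inv_mul_cancel_right₀ huw.snd_ne_zero]
      simp [hf, hw2]
  have hη2 : η ^ 2 = fibreProd J ξ ∨ η ^ 2 = -fibreProd J ξ := by
    have h1 := hτP _ _ hη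
    have hq := P.mul (P.fibreProd hξ hξt.ne_zero' J) (P.inv hη hη0)
    rcases apply_snd_of_mem_coordGroup hab hτJ with e | e | e | e
    · exact absurd e hτb
    · exact absurd (P.unique (e ▸ h1) (P.neg hη)) (hηt.two_ne_zero_and h2).1
    · left
      have := P.unique (e ▸ h1) hq
      rw [sq]
      nth_rewrite 1 [this]
      rw [inv_mul_cancel_right₀ hη0]
    · right
      have := P.unique (e ▸ h1) (P.neg hq)
      rw [sq]
      nth_rewrite 1 [this]
      rw [neg_mul, inv_mul_cancel_right₀ hη0]
  obtain ⟨c, hc, hcη⟩ : ∃ c : k, (c ^ 2 = 1 ∨ c ^ 2 = -1) ∧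
      (algebraMap k Ω c * η) ^ 2 = fibreProd J ξ := by
    rcases hη2 with e | e
    · exact ⟨1, Or.inl (one_pow 2), by simpa using e⟩
    · obtain ⟨c, hc⟩ := IsAlgClosed.exists_pow_nat_eq (-1 : k) two_pos
      exact ⟨c, Or.inr hc, by rw [mul_pow, ← map_pow, hc, e]; simp⟩
  have hc0 : c ≠ 0 := by rintro rfl; simp at hc
  have hab' := hab.algebraMap_mul_snd hc0
  have hη' := P.mul (P.algebraMap c) hη
  rw [← hab.coordGroup_mul_algebraMap J hc] at hG
  have htop : adjoin k {ξ, algebraMap k Ω c * η} = ⊤ := by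
    refine top_le_iff.1 fun ω _ => ?_
    obtain ⟨z, hz⟩ := hC.surjective ω
    exact mem_of_mem_placeGraph P hab'.transcendental_snd hab'.adjoin_snd _
      (fun e => (P.exists_value_of_mem_adjoin hξ hξt e.2).imp
        fun _ hω => ⟨adjoin.mono _ _ _ (by simp) hω.1, hω.2⟩)
      ⟨_, subset_adjoin _ _ (by simp), hη'⟩ hz
  refine ⟨?_, ξ, algebraMap k Ω c * η, hξt, hcη, htop, ?_, ?_⟩
  · rw [Finset.nonempty_iff_ne_empty]
    rintro rfl
    have h1 : (algebraMap k Ω c * η) ^ 2 = algebraMap k Ω 1 := by rw [hcη]; simp [fibreProd]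
    refine (hηt.pow two_pos).ne_algebraMap ((c ^ 2)⁻¹ * 1) ?_
    rw [map_mul, ← h1, map_inv₀, map_pow, mul_pow, inv_mul_cancel_left₀]
    exact pow_ne_zero 2 (by simpa using hc0)
  · refine mem_adjoin_of_invariant h2Ω huw hC.equivariant hC.fst hC.snd hx0 hC.sq_eq
      hC.adjoin_eq_top (v := a ^ 2 + (a ^ 2)⁻¹) (fun g hg => ?_)
      (P.add (P.pow hξ 2) (P.inv (P.pow hξ 2) (pow_ne_zero 2 hξt.ne_zero')))
    exact ((mem_coordGroup_iff hab' J g).1 (hG ▸ hg)).1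
  · refine mem_adjoin_of_invariant h2Ω hab' (fun g hg => hC.equivariant g (hG ▸ hg)) hξ hη'
      hξt.ne_zero' hcη ?_ (v := u ^ 2 + (u ^ 2)⁻¹) (fun g hg => ?_)
      (P.add (P.pow hC.fst 2) (P.inv (P.pow hC.fst 2) (pow_ne_zero 2 hx0)))
    · exact htop
    · exact ((mem_coordGroup_iff huw I g).1 (hG ▸ hg)).1

end CompareCurves

section Moebius

open OnePoint

variable {k : Type*} [Field k]

@[simp] lemma moebius_coe (a b c d z : k) : moebius k a b c d (z : OnePoint k) =
    if c * z + d = 0 then ∞ else (((a * z + b) / (c * z + d) : k) : OnePoint k) := rfl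

@[simp] lemma moebius_infty (a b c d : k) : moebius k a b c d ∞ =
    if c = 0 then ∞ else ((a / c : k) : OnePoint k) := rfl

lemma moebius_eq_smul {a b c d : k} (h : a * d - b * c ≠ 0) (z : OnePoint k) :
    moebius k a b c d z = Matrix.GeneralLinearGroup.mkOfDetNeZero !![a, b; c, d]
      (by rwa [Matrix.det_fin_two_of]) • z := by
  cases z with
  | infty =>
    rw [smul_infty_eq_ite]
    simp [Matrix.GeneralLinearGroup.mkOfDetNeZero]
  | coe z =>
    rw [smul_some_eq_ite]
    simp [Matrix.GeneralLinearGroup.mkOfDetNeZero]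

lemma moebius_comp {a b c d a' b' c' d' : k} (h : a * d - b * c ≠ 0)
    (h' : a' * d' - b' * c' ≠ 0) (z : OnePoint k) :
    moebius k a' b' c' d' (moebius k a b c d z) =
      moebius k (a' * a + b' * c) (a' * b + b' * d) (c' * a + d' * c) (c' * b + d' * d) z := by
  have h'' : (a' * a + b' * c) * (c' * b + d' * d) - (a' * b + b' * d) * (c' * a + d' * c) ≠ 0 := by
    have := mul_ne_zero h' h
    intro h0
    exact this (by linear_combination h0)
  rw [moebius_eq_smul h, moebius_eq_smul h', moebius_eq_smul h'', smul_smul]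
  congr 1
  ext i j
  fin_cases i <;> fin_cases j <;>
    simp [Matrix.GeneralLinearGroup.mkOfDetNeZero, Matrix.mul_apply, Fin.sum_univ_two]

lemma moebius_scalar {e : k} (he : e ≠ 0) (z : OnePoint k) : moebius k e 0 0 e z = z := by
  cases z with
  | infty => simp
  | coe z => simp [he]

lemma moebius_leftInverse {a b c d : k} (h : a * d - b * c ≠ 0) :
    Function.LeftInverse (moebius k d (-b) (-c) a) (moebius k a b c d) := by
  intro z
  rw [moebius_comp h (by intro h0; exact h (by linear_combination h0))]
  have e1 : d * a + -b * c = a * d - b * c := by ring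
  have e2 : d * b + -b * d = 0 := by ring
  have e3 : -c * a + a * c = 0 := by ring
  have e4 : -c * b + a * d = a * d - b * c := by ring
  rw [e1, e2, e3, e4, moebius_scalar h]

lemma moebius_rightInverse {a b c d : k} (h : a * d - b * c ≠ 0) :
    Function.RightInverse (moebius k d (-b) (-c) a) (moebius k a b c d) := by
  have := moebius_leftInverse (a := d) (b := -b) (c := -c) (d := a)
    (by intro h0; exact h (by linear_combination h0))
  rw [neg_neg, neg_neg] at this
  exact this

end Moebius

section RationalGenerators

open IntermediateField

variable {k Ω : Type*} [Field k] [Field Ω] [Algebra k Ω]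

lemma Transcendental.of_mem_adjoin {s t : Ω} (ht : Transcendental k t) (h : t ∈ k⟮s⟯) :
    Transcendental k s := by
  intro hs
  have := isAlgebraic_adjoin_simple hs.isIntegral
  refine ht ?_
  exact (isAlgebraic_algebraMap_iff (algebraMap k⟮s⟯ Ω).injective).2
    (Algebra.IsAlgebraic.isAlgebraic (R := k) (⟨t, h⟩ : k⟮s⟯))

/-- Two generators of a rational function field differ by a homography. -/
lemma exists_homography_of_mem_adjoin {s t : Ω} (ht : Transcendental k t) (hst : s ∈ k⟮t⟯)
    (hts : t ∈ k⟮s⟯) : ∃ a b c d : k, a * d - b * c ≠ 0 ∧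
      s * (algebraMap k Ω c * t + algebraMap k Ω d) = algebraMap k Ω a * t + algebraMap k Ω b := by
  let e := RatFunc.algEquivOfTranscendental t ht
  let f : RatFunc k →ₐ[k] Ω := k⟮t⟯.val.comp e.toAlgHom
  have hfX : ∀ p : Polynomial k, f (algebraMap (Polynomial k) (RatFunc k) p) =
      Polynomial.aeval t p := by
    intro p
    change ((RatFunc.algEquivOfTranscendental t ht _ : k⟮t⟯) : Ω) = _
    rw [RatFunc.algEquivOfTranscendental_algebraMap]
    simp
  obtain ⟨g, hg⟩ : ∃ g, f g = s := ⟨e.symm ⟨s, hst⟩, by simp [f]⟩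
  have hfg : (k⟮g⟯).map f = k⟮s⟯ := by rw [adjoin_map, Set.image_singleton, hg]
  have hgtop : k⟮g⟯ = ⊤ := by
    rw [← top_le_iff, ← RatFunc.adjoin_X, adjoin_simple_le_iff]
    rw [← hfg] at hts
    obtain ⟨y, hy, hyt⟩ := hts
    have : f RatFunc.X = t := by simpa using hfX Polynomial.X
    rwa [f.injective (this.trans hyt.symm)]
  have hdeg := RatFunc.finrank_eq_max_natDegree g
  rw [hgtop, IntermediateField.finrank_top] at hdeg
  have hnum : g.num.natDegree ≤ 1 := hdeg ▸ le_max_left _ _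
  have hden : g.denom.natDegree ≤ 1 := hdeg ▸ le_max_right _ _
  have hrel : s * Polynomial.aeval t g.denom = Polynomial.aeval t g.num := by
    rw [← hfX, ← hfX, ← hg, ← map_mul]
    congr 1
    nth_rewrite 1 [← RatFunc.num_div_denom g]
    exact div_mul_cancel₀ _ (RatFunc.algebraMap_ne_zero g.denom_ne_zero)
  obtain ⟨a, b, hab⟩ := Polynomial.exists_eq_X_add_C_of_natDegree_le_one hnum
  obtain ⟨c, d, hcd⟩ := Polynomial.exists_eq_X_add_C_of_natDegree_le_one hden
  rw [hab, hcd] at hrel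
  simp only [map_add, map_mul, Polynomial.aeval_C, Polynomial.aeval_X] at hrel
  refine ⟨a, b, c, d, fun h0 => ?_, hrel⟩
  have hs := ht.of_mem_adjoin hts
  have hd0 : algebraMap k Ω c * t + algebraMap k Ω d ≠ 0 := by
    intro h
    refine g.denom_ne_zero (hcd ▸ transcendental_iff.1 ht _ ?_)
    simpa using h
  have h0' : algebraMap k Ω a * algebraMap k Ω d = algebraMap k Ω b * algebraMap k Ω c := by
    rw [← map_mul, ← map_mul, sub_eq_zero.1 h0]
  have hsc : s * algebraMap k Ω c = algebraMap k Ω a :=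
    mul_right_cancel₀ hd0 (by linear_combination algebraMap k Ω c * hrel - h0')
  have hsd : s * algebraMap k Ω d = algebraMap k Ω b :=
    mul_right_cancel₀ hd0 (by linear_combination algebraMap k Ω d * hrel + t * h0')
  by_cases hc : c = 0
  · have hd : d ≠ 0 := by rintro rfl; simp [hc] at hd0
    refine hs.ne_algebraMap (b / d) ?_
    rw [map_div₀, eq_div_iff (by simpa using hd), hsd]
  · refine hs.ne_algebraMap (a / c) ?_
    rw [map_div₀, eq_div_iff (by simpa using hc), hsc]

/-- The multiplicities modulo two of the zeros and of the pole at infinity of a polynomial. -/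
noncomputable def parity (p : Polynomial k) : OnePoint k → ZMod 2
  | ∞ => p.natDegree
  | (c : k) => p.rootMultiplicity c

lemma parity_mul {p q : Polynomial k} (hp : p ≠ 0) (hq : q ≠ 0) :
    parity (p * q) = parity p + parity q := by
  funext z
  cases z with
  | infty => simp [parity, Polynomial.natDegree_mul hp hq]
  | coe c => simp [parity, Polynomial.rootMultiplicity_mul (mul_ne_zero hp hq)]

lemma parity_one : parity (1 : Polynomial k) = 0 := by
  funext z
  cases z with
  | infty => simp [parity]
  | coe c => simp [parity, Polynomial.rootMultiplicity_eq_zero (p := (1 : Polynomial k)) (x := c)]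

lemma parity_pow {p : Polynomial k} (hp : p ≠ 0) (n : ℕ) : parity (p ^ n) = n • parity p := by
  induction n with
  | zero => simp [parity_one]
  | succ n ih => rw [pow_succ, parity_mul (pow_ne_zero n hp) hp, ih, succ_nsmul]

lemma parity_prod {ι : Type*} (B : Finset ι) {f : ι → Polynomial k} (hf : ∀ i ∈ B, f i ≠ 0) :
    parity (∏ i ∈ B, f i) = ∑ i ∈ B, parity (f i) := by
  induction B using Finset.induction_on with
  | empty => simp [parity_one]
  | insert i B hi ih =>
    rw [Finset.prod_insert hi, Finset.sum_insert hi, parity_mul (hf i (by simp)), ih]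
    · exact fun j hj => hf j (Finset.mem_insert_of_mem hj)
    · exact Finset.prod_ne_zero_iff.2 fun j hj => hf j (Finset.mem_insert_of_mem hj)

/-- The parity of the divisor `[z] - [∞]`. -/
noncomputable def edge (z : OnePoint k) : OnePoint k → ZMod 2 := Pi.single z 1 + Pi.single ∞ 1

lemma linear_ne_zero {p q : k} (h : p ≠ 0 ∨ q ≠ 0) :
    (Polynomial.C p * Polynomial.X + Polynomial.C q : Polynomial k) ≠ 0 := by
  intro h0
  have h1 := congrArg (fun f => Polynomial.coeff f 1) h0
  have h2 := congrArg (fun f => Polynomial.coeff f 0) h0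
  simp at h1 h2
  simp [h1, h2] at h

lemma parity_linear {p q : k} (h : p ≠ 0 ∨ q ≠ 0) :
    parity (Polynomial.C p * Polynomial.X + Polynomial.C q) =
      edge (if p = 0 then ∞ else ((-q / p : k) : OnePoint k)) := by
  by_cases hp : p = 0
  · have hq : q ≠ 0 := by simpa [hp] using h
    funext z
    cases z with
    | infty => simp [parity, edge, hp, CharTwo.add_self_eq_zero]
    | coe c => simp [parity, edge, hp]
  · have e : (Polynomial.C p * Polynomial.X + Polynomial.C q : Polynomial k) =
        Polynomial.C p * (Polynomial.X - Polynomial.C (-q / p)) := by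
      rw [mul_sub, ← Polynomial.C_mul, mul_div_cancel₀ _ hp, Polynomial.C_neg, sub_neg_eq_add]
    rw [if_neg hp, e, parity_mul (by simpa using hp) (Polynomial.X_sub_C_ne_zero _)]
    funext z
    cases z with
    | infty => simp [parity, edge]
    | coe c => simp [parity, edge, Polynomial.rootMultiplicity_X_sub_C, Pi.single_apply]

lemma parity_X_sub_C (c : k) : parity (Polynomial.X - Polynomial.C c) = edge (c : OnePoint k) := by
  have := parity_linear (p := 1) (q := -c) (by simp)
  simpa [← sub_eq_add_neg] using this

lemma parity_sq {p : Polynomial k} (hp : p ≠ 0) : parity (p ^ 2) = 0 := by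
  rw [parity_pow hp, two_nsmul, CharTwo.add_self_eq_zero]

open Polynomial in
/-- A square relation between two generators of `k(t)`, read on divisors modulo two. -/
lemma sum_edge_eq {s t : Ω} (ht : Transcendental k t) {a b c d : k} (hdet : a * d - b * c ≠ 0)
    (hs : s * (algebraMap k Ω c * t + algebraMap k Ω d) = algebraMap k Ω a * t + algebraMap k Ω b)
    (hst : Transcendental k s)
    {B I : Finset k} {e₁ e₂ e₃ : ℕ} {g : Ω} (hg : g ∈ k⟮t⟯)
    (h : (∏ i ∈ B, (s - algebraMap k Ω i)) * (∏ i ∈ I, (t - algebraMap k Ω i)) ^ e₃ *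
      (t - 2) ^ e₂ * (t + 2) ^ e₁ = g ^ 2) :
    ∑ i ∈ B, (edge (moebius k d (-b) (-c) a i) + edge (moebius k d (-b) (-c) a ∞)) =
      e₃ • ∑ i ∈ I, edge (i : OnePoint k) + e₂ • edge ((2 : k) : OnePoint k) +
        e₁ • edge ((-2 : k) : OnePoint k) := by
  set N : k[X] := C a * X + C b with hN
  set D : k[X] := C c * X + C d with hD
  have hcd : c ≠ 0 ∨ d ≠ 0 := by
    by_contra! h0
    exact hdet (by simp [h0.1, h0.2])
  have hD0 : D ≠ 0 := linear_ne_zero hcd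
  have hNi : ∀ i, N - C i * D = C (a - i * c) * X + C (b - i * d) := by
    intro i
    simp only [hN, hD, C_sub, C_mul]
    ring
  have hni : ∀ i, a - i * c ≠ 0 ∨ b - i * d ≠ 0 := by
    intro i
    by_contra! h0
    exact hdet (by linear_combination d * h0.1 - c * h0.2)
  have hN0 : ∀ i, N - C i * D ≠ 0 := fun i => by
    rw [hNi]
    exact linear_ne_zero (hni i)
  have htD : aeval t D ≠ 0 := fun h0 => hD0 (transcendental_iff.1 ht _ h0)
  have hsN : ∀ i, (s - algebraMap k Ω i) * aeval t D = aeval t (N - C i * D) := by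
    intro i
    simp only [hN, hD, map_sub, map_add, map_mul, aeval_C, aeval_X]
    linear_combination hs
  obtain ⟨A, A', rfl⟩ := (mem_adjoin_simple_iff k g).1 hg
  have hX : ∀ i : k, (X - C i : k[X]) ≠ 0 := X_sub_C_ne_zero
  have hleft : (∏ i ∈ B, (s - algebraMap k Ω i)) * (∏ i ∈ I, (t - algebraMap k Ω i)) ^ e₃ *
      (t - 2) ^ e₂ * (t + 2) ^ e₁ ≠ 0 := by
    have ht' : ∀ i, t - algebraMap k Ω i ≠ 0 := fun i => sub_ne_zero.2 (ht.ne_algebraMap i)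
    have h1 := ht' 2
    have h2 := ht' (-2)
    rw [map_neg, sub_neg_eq_add] at h2
    rw [map_ofNat] at h1 h2
    refine mul_ne_zero (mul_ne_zero (mul_ne_zero ?_ (pow_ne_zero _ ?_)) (pow_ne_zero _ h1))
      (pow_ne_zero _ h2)
    · exact Finset.prod_ne_zero_iff.2 fun i _ => sub_ne_zero.2 (hst.ne_algebraMap i)
    · exact Finset.prod_ne_zero_iff.2 fun i _ => ht' i
  have hAA' : aeval t A / aeval t A' ≠ 0 := fun h0 => hleft (by rw [h, h0]; simp)
  obtain ⟨hA0, hA'0⟩ := div_ne_zero_iff.1 hAA'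
  have hA : A ≠ 0 := by rintro rfl; simp at hA0
  have hA' : A' ≠ 0 := by rintro rfl; simp at hA'0
  have hpoly : (∏ i ∈ B, ((N - C i * D) * D)) * (∏ i ∈ I, (X - C i)) ^ e₃ * (X - C 2) ^ e₂ *
      (X - C (-2)) ^ e₁ * A' ^ 2 = (A * D ^ B.card) ^ 2 := by
    refine sub_eq_zero.1 (transcendental_iff.1 ht _ ?_)
    have hprod : ∏ i ∈ B, (aeval t (N - C i * D) * aeval t D) =
        (∏ i ∈ B, (s - algebraMap k Ω i)) * (aeval t D ^ B.card) ^ 2 := by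
      rw [← pow_mul, mul_comm B.card, pow_mul, ← Finset.prod_const, ← Finset.prod_mul_distrib]
      exact Finset.prod_congr rfl fun i _ => by rw [← hsN]; ring
    rw [div_pow, eq_div_iff (pow_ne_zero 2 hA'0)] at h
    rw [map_sub, map_mul, map_mul, map_mul, map_mul, map_prod]
    simp only [map_mul]
    rw [hprod]
    have e2 : aeval t (X - C (-2) : k[X]) = t + 2 := by
      rw [map_sub, aeval_X, aeval_C, map_neg, map_ofNat, sub_neg_eq_add]
    rw [map_pow (aeval t) (X - C (-2)), e2]
    simp only [map_pow, map_prod, map_sub, map_mul, aeval_C, aeval_X, map_ofNat]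
    linear_combination (aeval t D ^ B.card) ^ 2 * h
  have hpar := congrArg parity hpoly
  have h1 : ∏ i ∈ B, ((N - C i * D) * D) ≠ 0 :=
    Finset.prod_ne_zero_iff.2 fun i _ => mul_ne_zero (hN0 i) hD0
  have h2 : ∏ i ∈ I, (X - C i : k[X]) ≠ 0 := Finset.prod_ne_zero_iff.2 fun i _ => hX i
  have h3 := mul_ne_zero h1 (pow_ne_zero e₃ h2)
  have h4 := mul_ne_zero h3 (pow_ne_zero e₂ (hX 2))
  have h5 := mul_ne_zero h4 (pow_ne_zero e₁ (hX (-2)))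
  rw [parity_sq (mul_ne_zero hA (pow_ne_zero _ hD0)), parity_mul h5 (pow_ne_zero 2 hA'),
    parity_sq hA', add_zero, parity_mul h4 (pow_ne_zero _ (hX _)),
    parity_mul h3 (pow_ne_zero _ (hX _)), parity_mul h1 (pow_ne_zero _ h2),
    parity_prod _ fun i _ => mul_ne_zero (hN0 i) hD0, parity_pow h2, parity_pow (hX _),
    parity_pow (hX _), parity_prod _ fun i _ => hX i, add_assoc, add_assoc,
    CharTwo.add_eq_zero] at hpar
  simp only [parity_X_sub_C] at hpar
  rw [add_assoc, ← hpar]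
  refine Finset.sum_congr rfl fun i _ => ?_
  rw [parity_mul (hN0 i) hD0, hNi, parity_linear (hni i), parity_linear hcd, moebius_coe,
    moebius_infty]
  congr 2
  · have e1 : -c * i + a = a - i * c := by ring
    have e2 : d * i + -b = -(b - i * d) := by ring
    rw [e1, e2]
  · by_cases hc : c = 0
    · simp [hc]
    · rw [if_neg hc, if_neg (neg_ne_zero.2 hc), div_neg, neg_div]

end RationalGenerators

section Combinatorics

variable {k : Type*} [Field k]

/-- The three points `2`, `-2`, `∞` of the projective line. -/
abbrev triple (k : Type*) [Field k] : Set (OnePoint k) :=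
  {((2 : k) : OnePoint k), ((-2 : k) : OnePoint k), (∞ : OnePoint k)}

/-- The image of a finite subset of `k` in the projective line. -/
abbrev pts (I : Finset k) : Set (OnePoint k) := (fun x : k => (x : OnePoint k)) '' (I : Set k)

/-- Two finite sets are exchanged by a homography which preserves `{2, -2, ∞}`. -/
def TripleEquiv (I J : Finset k) : Prop :=
  ∃ a b c d : k, a * d - b * c ≠ 0 ∧ moebius k a b c d '' triple k = triple k ∧
    moebius k a b c d '' pts I = pts J

lemma two_ne_neg_two (h2 : (2 : k) ≠ 0) : (2 : k) ≠ -2 := by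
  intro h
  have : (2 : k) * 2 = 0 := by linear_combination h
  simp [h2] at this

lemma ncard_triple (h2 : (2 : k) ≠ 0) : (triple k).ncard = 3 := by
  rw [Set.ncard_eq_three]
  exact ⟨_, _, _, by simpa using two_ne_neg_two h2, by simp, by simp, rfl⟩

lemma finite_triple_union_pts (I : Finset k) : (triple k ∪ pts I).Finite :=
  (Set.toFinite _).union (I.finite_toSet.image _)

lemma coe_notMem_triple {I : Finset k} (hI : ∀ a ∈ I, a ≠ 2 ∧ a ≠ -2) {a : k} (ha : a ∈ I) :
    (a : OnePoint k) ∉ triple k := by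
  simpa using hI a ha

lemma tripleEquiv_of_mapsTo {I J : Finset k}
    (hI : ∀ a ∈ I, a ≠ 2 ∧ a ≠ -2) (hJ : ∀ a ∈ J, a ≠ 2 ∧ a ≠ -2) {a b c d : k}
    (hdet : a * d - b * c ≠ 0)
    (hT : Set.MapsTo (moebius k a b c d) (triple k) (triple k))
    (h : ∀ i ∈ I, moebius k a b c d i ∈ triple k ∪ pts J)
    (h' : ∀ j ∈ J, moebius k d (-b) (-c) a j ∈ triple k ∪ pts I) : TripleEquiv I J := by
  have hl := moebius_leftInverse hdet
  have hr := moebius_rightInverse hdet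
  have himg : moebius k a b c d '' triple k = triple k :=
    Set.eq_of_subset_of_ncard_le hT.image_subset
      (by rw [Set.ncard_image_of_injective _ hl.injective]) (by simp)
  refine ⟨a, b, c, d, hdet, himg, Set.Subset.antisymm ?_ ?_⟩
  · rintro _ ⟨_, ⟨i, hi, rfl⟩, rfl⟩
    refine (h i hi).resolve_left fun hm => coe_notMem_triple hI hi ?_
    rw [← himg] at hm
    obtain ⟨z, hz, hzi⟩ := hm
    rwa [← hl.injective hzi]
  · rintro _ ⟨j, hj, rfl⟩
    refine ⟨_, (h' j hj).resolve_left fun hm => coe_notMem_triple hJ hj ?_, hr j⟩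
    have := hT hm
    rwa [hr] at this

/-- The values of `ν` on a finite set and at infinity are compatible with `I` modulo two. -/
def Compatible (I : Finset k) (ν : OnePoint k → OnePoint k) (B : Finset k) : Prop :=
  ∃ e : ZMod 2, ∀ a : k, a ≠ 2 → a ≠ -2 →
    ∑ i ∈ B, ((if (a : OnePoint k) = ν i then 1 else 0) +
      if (a : OnePoint k) = ν ∞ then 1 else 0) = if a ∈ I then e else 0

lemma compatible_of_sum_edge_eq {I B : Finset k} {ν : OnePoint k → OnePoint k} {e₁ e₂ e₃ : ℕ}
    (h : ∑ i ∈ B, (edge (ν i) + edge (ν ∞)) =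
      e₃ • ∑ i ∈ I, edge (i : OnePoint k) + e₂ • edge ((2 : k) : OnePoint k) +
        e₁ • edge ((-2 : k) : OnePoint k)) : Compatible I ν B := by
  refine ⟨e₃, fun a h2 h2' => ?_⟩
  have := congrFun h a
  simpa [edge, Pi.single_apply, h2, h2', Finset.sum_apply] using this

lemma Compatible.mem {I B : Finset k} {ν : OnePoint k → OnePoint k} (hν : ν.Injective)
    (h : Compatible I ν B) {i : k} (hi : i ∈ B) : ν i ∈ triple k ∪ pts I := by
  obtain ⟨e, h⟩ := h
  by_contra hm
  simp only [Set.mem_union, not_or] at hm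
  obtain ⟨a, ha⟩ : ∃ a : k, (a : OnePoint k) = ν i :=
    OnePoint.ne_infty_iff_exists.1 fun h0 => hm.1 (by simp [h0])
  rw [← ha] at hm
  have hm1 : a ≠ 2 ∧ a ≠ -2 := by simpa using hm.1
  have hm2 : a ∉ I := by simpa using hm.2
  have := h a hm1.1 hm1.2
  simp [ha, hν.eq_iff, hi, hm2] at this

lemma Compatible.infty_mem {I : Finset k} {ν : OnePoint k → OnePoint k} (hν : ν.Injective)
    {p : k} (h : Compatible I ν {p}) : ν ∞ ∈ triple k ∪ pts I := by
  obtain ⟨e, h⟩ := h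
  by_contra hm
  simp only [Set.mem_union, not_or] at hm
  obtain ⟨a, ha⟩ : ∃ a : k, (a : OnePoint k) = ν ∞ :=
    OnePoint.ne_infty_iff_exists.1 fun h0 => hm.1 (by simp [h0])
  rw [← ha] at hm
  have hm1 : a ≠ 2 ∧ a ≠ -2 := by simpa using hm.1
  have hm2 : a ∉ I := by simpa using hm.2
  have := h a hm1.1 hm1.2
  simp [ha, hν.eq_iff, hm2] at this

/-- A map compatible with `{2}`, `{-2}` and `J`. -/
structure FullyCompatible (I J : Finset k) (ν : OnePoint k → OnePoint k) : Prop where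
  two : Compatible I ν {2}
  neg_two : Compatible I ν {-2}
  set : Compatible I ν J

lemma FullyCompatible.mapsTo {I J : Finset k} {ν : OnePoint k → OnePoint k} (hν : ν.Injective)
    (h : FullyCompatible I J ν) :
    Set.MapsTo ν (triple k ∪ pts J) (triple k ∪ pts I) := by
  rintro _ ((rfl | rfl | rfl) | ⟨j, hj, rfl⟩)
  · exact h.two.mem hν (by simp)
  · exact h.neg_two.mem hν (by simp)
  · exact h.two.infty_mem hν
  · exact h.set.mem hν hj

lemma FullyCompatible.exists_sum_eq {I J : Finset k} {ν : OnePoint k → OnePoint k}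
    (hI : ∀ a ∈ I, a ≠ 2 ∧ a ≠ -2) (h : FullyCompatible I J ν) {p q : OnePoint k}
    (hp : p ∈ triple k) (hq : q ∈ triple k) :
    ∃ e : ZMod 2, ∀ a ∈ I, ((if (a : OnePoint k) = ν p then 1 else 0) +
      if (a : OnePoint k) = ν q then 1 else 0) = e := by
  have key : ∀ p ∈ triple k, ∃ e : ZMod 2, ∀ a ∈ I, ((if (a : OnePoint k) = ν p then 1 else 0) +
      if (a : OnePoint k) = ν ∞ then 1 else 0) = e := by
    rintro _ (rfl | rfl | rfl)
    · obtain ⟨e, he⟩ := h.two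
      exact ⟨e, fun a ha => by simpa [ha] using he a (hI a ha).1 (hI a ha).2⟩
    · obtain ⟨e, he⟩ := h.neg_two
      exact ⟨e, fun a ha => by simpa [ha] using he a (hI a ha).1 (hI a ha).2⟩
    · exact ⟨0, fun a _ => CharTwo.add_self_eq_zero _⟩
  obtain ⟨e, he⟩ := key p hp
  obtain ⟨e', he'⟩ := key q hq
  refine ⟨e + e', fun a ha => ?_⟩
  rw [← he a ha, ← he' a ha, add_add_add_comm, CharTwo.add_self_eq_zero, add_zero]

lemma exists_two_others (h2 : (2 : k) ≠ 0) {p : OnePoint k} (hp : p ∈ triple k) :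
    ∃ q ∈ triple k, ∃ q' ∈ triple k, q ≠ p ∧ q' ≠ p ∧ q ≠ q' := by
  have h : ((2 : k) : OnePoint k) ≠ ((-2 : k) : OnePoint k) := by simpa using two_ne_neg_two h2
  rcases hp with rfl | rfl | rfl
  · exact ⟨_, .inr (.inl rfl), _, .inr (.inr rfl), h.symm, by simp, by simp⟩
  · exact ⟨_, .inl rfl, _, .inr (.inr rfl), h, by simp, by simp⟩
  · exact ⟨_, .inl rfl, _, .inr (.inl rfl), by simp, by simp, h⟩

lemma FullyCompatible.mapsTo_triple (h2 : (2 : k) ≠ 0) {I J : Finset k}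
    {ν : OnePoint k → OnePoint k} (hν : ν.Injective) (hI : ∀ a ∈ I, a ≠ 2 ∧ a ≠ -2)
    (h : FullyCompatible I J ν) (hcard : 1 < I.card) :
    Set.MapsTo ν (triple k) (triple k) := by
  intro p hp
  refine (h.mapsTo hν (.inl hp)).resolve_right ?_
  rintro ⟨a, ha, hap⟩
  obtain ⟨a', ha', hne⟩ := Finset.exists_mem_ne hcard a
  have key : ∀ q ∈ triple k, q ≠ p → (a' : OnePoint k) = ν q := by
    intro q hq hqp
    obtain ⟨e, he⟩ := h.exists_sum_eq hI hp hq
    have h1 := he a ha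
    have h3 := he a' ha'
    simp only at hap
    simp only [hap, hν.eq_iff, hqp.symm] at h1
    have h4 : (a' : OnePoint k) ≠ ν p := by rw [← hap]; simpa using hne
    simp only [h4] at h3
    by_contra h5
    simp only [h5] at h3
    simp [← h3] at h1
  obtain ⟨q, hq, q', hq', hqp, hqp', hqq⟩ := exists_two_others h2 hp
  exact hqq (hν ((key q hq hqp).symm.trans (key q' hq' hqp')))

lemma moebius_coe_of_ne {a b c d z w : k} (h : c * z + d ≠ 0) (hw : a * z + b = w * (c * z + d)) :
    moebius k a b c d z = w := by
  rw [moebius_coe, if_neg h, hw, mul_div_cancel_right₀ _ h]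

lemma moebius_coe_of_eq {a b c d z : k} (h : c * z + d = 0) : moebius k a b c d z = ∞ := by
  rw [moebius_coe, if_pos h]

lemma moebius_infty_of_ne {a b c d w : k} (h : c ≠ 0) (hw : a = w * c) :
    moebius k a b c d ∞ = w := by
  rw [moebius_infty, if_neg h, hw, mul_div_cancel_right₀ _ h]

/-- A double transposition of the four points `2`, `-2`, `∞`, `β` moving a prescribed one to
`β`. -/
lemma exists_klein (h2 : (2 : k) ≠ 0) {β : k} (hβ : β ≠ 2 ∧ β ≠ -2) {τ : OnePoint k}
    (hτ : τ ∈ triple k) : ∃ a b c d : k, a * d - b * c ≠ 0 ∧ moebius k a b c d τ = β ∧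
      Set.MapsTo (moebius k a b c d) (triple k ∪ pts {β}) (triple k ∪ pts {β}) := by
  have hm : β - 2 ≠ 0 := sub_ne_zero.2 hβ.1
  have hp : β + 2 ≠ 0 := fun h => hβ.2 (by linear_combination h)
  have h4 : (4 : k) ≠ 0 := by
    rw [show (4 : k) = 2 * 2 by norm_num]
    exact mul_ne_zero h2 h2
  have mem2 : ((2 : k) : OnePoint k) ∈ triple k ∪ pts {β} := by simp
  have mem2' : ((-2 : k) : OnePoint k) ∈ triple k ∪ pts {β} := by simp
  have memi : (∞ : OnePoint k) ∈ triple k ∪ pts {β} := by simp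
  have memb : (β : OnePoint k) ∈ triple k ∪ pts {β} := by simp
  rcases hτ with rfl | rfl | rfl
  · have e1 : moebius k (-2) (4 * β + 4) 1 2 (2 : k) = β :=
      moebius_coe_of_ne (by convert h4 using 1; norm_num) (by ring)
    have e2 : moebius k (-2) (4 * β + 4) 1 2 (-2 : k) = ∞ := moebius_coe_of_eq (by ring)
    have e3 : moebius k (-2) (4 * β + 4) 1 2 ∞ = (-2 : k) :=
      moebius_infty_of_ne one_ne_zero (by ring)
    have e4 : moebius k (-2) (4 * β + 4) 1 2 β = (2 : k) :=
      moebius_coe_of_ne (by simpa using hp) (by ring)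
    refine ⟨_, _, _, _, ?_, e1, ?_⟩
    · have := mul_ne_zero h4 hp
      exact fun h => this (by linear_combination -h)
    · rintro _ ((rfl | rfl | rfl) | ⟨j, hj, rfl⟩)
      · rwa [e1]
      · rwa [e2]
      · rwa [e3]
      · rw [Finset.coe_singleton, Set.mem_singleton_iff] at hj
        simp only [hj, e4]
        exact mem2
  · have e1 : moebius k 2 (4 - 4 * β) 1 (-2) (-2 : k) = β :=
      moebius_coe_of_ne (by convert neg_ne_zero.2 h4 using 1; norm_num) (by ring)
    have e2 : moebius k 2 (4 - 4 * β) 1 (-2) (2 : k) = ∞ := moebius_coe_of_eq (by ring)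
    have e3 : moebius k 2 (4 - 4 * β) 1 (-2) ∞ = (2 : k) :=
      moebius_infty_of_ne one_ne_zero (by ring)
    have e4 : moebius k 2 (4 - 4 * β) 1 (-2) β = (-2 : k) :=
      moebius_coe_of_ne (by simpa [← sub_eq_add_neg] using hm) (by ring)
    refine ⟨_, _, _, _, ?_, e1, ?_⟩
    · have := mul_ne_zero h4 hm
      exact fun h => this (by linear_combination h)
    · rintro _ ((rfl | rfl | rfl) | ⟨j, hj, rfl⟩)
      · rwa [e2]
      · rwa [e1]
      · rwa [e3]
      · rw [Finset.coe_singleton, Set.mem_singleton_iff] at hj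
        simp only [hj, e4]
        exact mem2'
  · have e1 : moebius k β (-4) 1 (-β) ∞ = β := moebius_infty_of_ne one_ne_zero (by ring)
    have e2 : moebius k β (-4) 1 (-β) (2 : k) = (-2 : k) :=
      moebius_coe_of_ne (fun h => hm (by linear_combination -h)) (by ring)
    have e3 : moebius k β (-4) 1 (-β) (-2 : k) = (2 : k) :=
      moebius_coe_of_ne (fun h => hp (by linear_combination -h)) (by ring)
    have e4 : moebius k β (-4) 1 (-β) β = ∞ := moebius_coe_of_eq (by ring)
    refine ⟨_, _, _, _, ?_, e1, ?_⟩
    · have := mul_ne_zero hm hp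
      exact fun h => this (by linear_combination -h)
    · rintro _ ((rfl | rfl | rfl) | ⟨j, hj, rfl⟩)
      · rwa [e2]
      · rwa [e3]
      · rwa [e1]
      · rw [Finset.coe_singleton, Set.mem_singleton_iff] at hj
        simp only [hj, e4]
        exact memi

lemma tripleEquiv_singleton_of_eq {α β : k} (hα : α ≠ 2 ∧ α ≠ -2)
    (hβ : β ≠ 2 ∧ β ≠ -2) {a b c d : k} (hdet : a * d - b * c ≠ 0)
    (hm : Set.MapsTo (moebius k a b c d) (triple k ∪ pts {α}) (triple k ∪ pts {β}))
    (h : moebius k a b c d α = β) : TripleEquiv {α} {β} := by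
  have hl := moebius_leftInverse hdet
  refine tripleEquiv_of_mapsTo (by simpa using hα) (by simpa using hβ) hdet ?_ ?_ ?_
  · intro z hz
    refine (hm (.inl hz)).resolve_right ?_
    rintro ⟨j, hj, hjz⟩
    rw [Finset.coe_singleton, Set.mem_singleton_iff] at hj
    simp only [hj, ← h] at hjz
    rw [← hl.injective hjz] at hz
    exact coe_notMem_triple (I := {α}) (by simpa using hα) (by simp) hz
  · simp only [Finset.mem_singleton, forall_eq]
    rw [h]
    simp
  · simp only [Finset.mem_singleton, forall_eq]
    rw [← h, hl]
    simp

lemma tripleEquiv_singleton (h2 : (2 : k) ≠ 0) {α β : k} (hα : α ≠ 2 ∧ α ≠ -2)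
    (hβ : β ≠ 2 ∧ β ≠ -2) {a b c d : k} (hdet : a * d - b * c ≠ 0)
    (hm : Set.MapsTo (moebius k a b c d) (triple k ∪ pts {α}) (triple k ∪ pts {β})) :
    TripleEquiv {α} {β} := by
  rcases hm (.inr ⟨α, by simp, rfl⟩) with h | h
  · obtain ⟨a', b', c', d', hdet', hb, hm'⟩ := exists_klein h2 hβ h
    have hcomp := moebius_comp hdet hdet'
    refine tripleEquiv_singleton_of_eq hα hβ (a := a' * a + b' * c) (b := a' * b + b' * d)
      (c := c' * a + d' * c) (d := c' * b + d' * d) ?_ ?_ ?_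
    · have := mul_ne_zero hdet hdet'
      exact fun h => this (by linear_combination h)
    · intro z hz
      rw [← hcomp]
      exact hm' (hm hz)
    · rw [← hcomp, hb]
  · refine tripleEquiv_singleton_of_eq hα hβ hdet hm ?_
    obtain ⟨j, hj, hjz⟩ := h
    rw [Finset.coe_singleton, Set.mem_singleton_iff] at hj
    rw [← hjz, hj]

lemma ncard_triple_union_pts (h2 : (2 : k) ≠ 0) {I : Finset k} (hI : ∀ a ∈ I, a ≠ 2 ∧ a ≠ -2) :
    (triple k ∪ pts I).ncard = 3 + I.card := by
  rw [Set.ncard_union_eq ?_ (Set.toFinite _) (I.finite_toSet.image _), ncard_triple h2,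
    Set.ncard_image_of_injective _ OnePoint.coe_injective, Set.ncard_coe_finset]
  rw [Set.disjoint_right]
  rintro _ ⟨i, hi, rfl⟩
  exact coe_notMem_triple hI hi

lemma tripleEquiv_of_fullyCompatible (h2 : (2 : k) ≠ 0) {I J : Finset k}
    (hI : ∀ a ∈ I, a ≠ 2 ∧ a ≠ -2) (hJ : ∀ a ∈ J, a ≠ 2 ∧ a ≠ -2) (hIne : I.Nonempty)
    (hJne : J.Nonempty) {a b c d : k} (hdet : a * d - b * c ≠ 0)
    (h : FullyCompatible J I (moebius k a b c d))
    (h' : FullyCompatible I J (moebius k d (-b) (-c) a)) : TripleEquiv I J := by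
  have hl := moebius_leftInverse hdet
  have hr := moebius_rightInverse hdet
  have hm := h.mapsTo hl.injective
  have hm' := h'.mapsTo hr.injective
  have hle : I.card ≤ J.card := by
    have := Set.ncard_le_ncard hm.image_subset (finite_triple_union_pts J)
    rw [Set.ncard_image_of_injective _ hl.injective, ncard_triple_union_pts h2 hI,
      ncard_triple_union_pts h2 hJ] at this
    omega
  have hle' : J.card ≤ I.card := by
    have := Set.ncard_le_ncard hm'.image_subset (finite_triple_union_pts I)
    rw [Set.ncard_image_of_injective _ hr.injective, ncard_triple_union_pts h2 hI,
      ncard_triple_union_pts h2 hJ] at this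
    omega
  by_cases hcard : 1 < J.card
  · exact tripleEquiv_of_mapsTo hI hJ hdet (h.mapsTo_triple h2 hl.injective hJ hcard)
      (fun i hi => hm (.inr ⟨i, hi, rfl⟩)) fun j hj => hm' (.inr ⟨j, hj, rfl⟩)
  · have h1 := hIne.card_pos
    have h3 := hJne.card_pos
    obtain ⟨α, rfl⟩ := Finset.card_eq_one.1 (show I.card = 1 by omega)
    obtain ⟨β, rfl⟩ := Finset.card_eq_one.1 (show J.card = 1 by omega)
    exact tripleEquiv_singleton h2 (hI α (by simp)) (hJ β (by simp)) hdet hm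

end Combinatorics

section CoordGroupInvariant

open IntermediateField

variable {k Ω : Type*} [Field k] [Field Ω] [Algebra k Ω]

lemma fullyCompatible_of_homography (h2 : (2 : Ω) ≠ 0) {I J : Finset k} {x r ξ η : Ω}
    (hx : Transcendental k x) (hr : r ^ 2 = fibreProd I x) (htop : adjoin k {x, r} = ⊤)
    (hξ : Transcendental k ξ) (hη : η ^ 2 = fibreProd J ξ)
    (hst : ξ ^ 2 + (ξ ^ 2)⁻¹ ∈ k⟮x ^ 2 + (x ^ 2)⁻¹⟯) {a b c d : k} (hdet : a * d - b * c ≠ 0)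
    (h : (ξ ^ 2 + (ξ ^ 2)⁻¹) * (algebraMap k Ω c * (x ^ 2 + (x ^ 2)⁻¹) + algebraMap k Ω d) =
      algebraMap k Ω a * (x ^ 2 + (x ^ 2)⁻¹) + algebraMap k Ω b) :
    FullyCompatible I J (moebius k d (-b) (-c) a) := by
  have hξ0 := hξ.ne_zero'
  have key : ∀ (B : Finset k) (g : Ω),
      ∏ i ∈ B, (ξ ^ 2 + (ξ ^ 2)⁻¹ - algebraMap k Ω i) = g ^ 2 →
        Compatible I (moebius k d (-b) (-c) a) B := by
    intro B g hg
    obtain ⟨e₁, e₂, e₃, g', hg', h'⟩ := exists_mul_eq_sq h2 hx.ne_zero' hr htop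
      (prod_mem fun i _ => sub_mem hst (IntermediateField.algebraMap_mem _ i)) hg
    exact compatible_of_sum_edge_eq
      (sum_edge_eq hx.pow_two_add_inv hdet h hξ.pow_two_add_inv hg' h')
  refine ⟨key _ (ξ - ξ⁻¹) ?_, key _ (ξ + ξ⁻¹) ?_, key _ η hη.symm⟩
  · rw [Finset.prod_singleton, map_ofNat]
    field_simp
    ring
  · rw [Finset.prod_singleton, map_neg, map_ofNat]
    field_simp
    ring

variable {K : Type*} [Field K] [Algebra k K] [IsAlgClosed k]

lemma IsCoord.nonempty_of_coordGroup_eq (h2 : (2 : k) ≠ 0) {I J : Finset k}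
    (hI : ∀ a ∈ I, a ≠ 2 ∧ a ≠ -2) {u w a b : K} (huw : IsCoord k u w) (hab : IsCoord k a b)
    (h : coordGroup k I u w = coordGroup k J a b) (hne : I.Nonempty) : J.Nonempty := by
  obtain ⟨_, _, _, P, x, r, hC⟩ := huw.exists_isFixedCurve h2 hI hne
  exact (hC.exists_second_model h2 huw hab h).1

lemma IsCoord.tripleEquiv_of_coordGroup_eq (h2 : (2 : k) ≠ 0) {I J : Finset k}
    (hI : ∀ a ∈ I, a ≠ 2 ∧ a ≠ -2) (hJ : ∀ a ∈ J, a ≠ 2 ∧ a ≠ -2) {u w a b : K}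
    (huw : IsCoord k u w) (hab : IsCoord k a b)
    (h : coordGroup k I u w = coordGroup k J a b) : TripleEquiv I J := by
  rcases I.eq_empty_or_nonempty with rfl | hne
  · rcases J.eq_empty_or_nonempty with rfl | hJne
    · refine ⟨1, 0, 0, 1, by simp, ?_, ?_⟩ <;>
        simp [funext (moebius_scalar (one_ne_zero (α := k)))]
    · exact absurd (hab.nonempty_of_coordGroup_eq h2 hJ huw h.symm hJne) (by simp)
  · obtain ⟨_, p, _, P, x, r, hC⟩ := huw.exists_isFixedCurve h2 hI hne
    have h2' : (2 : AdjoinRoot p) ≠ 0 := by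
      rw [← map_ofNat (algebraMap k (AdjoinRoot p))]
      exact (map_ne_zero _).2 h2
    obtain ⟨hJne, ξ, η, hξ, hη, htop, hst, hts⟩ := hC.exists_second_model h2 huw hab h
    obtain ⟨a', b', c', d', hdet, hs⟩ :=
      exists_homography_of_mem_adjoin hC.transcendental.pow_two_add_inv hst hts
    have h1 := fullyCompatible_of_homography h2' hC.transcendental hC.sq_eq hC.adjoin_eq_top
      hξ hη hst hdet hs
    have h3 := fullyCompatible_of_homography h2' hξ hη htop hC.transcendental hC.sq_eq hts
      (a := d') (b := -b') (c := -c') (d := a') (fun h0 => hdet (by linear_combination h0)) (by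
        simp only [map_neg]
        linear_combination -hs)
    rw [neg_neg, neg_neg] at h3
    exact tripleEquiv_of_fullyCompatible h2 hI hJ hne hJne hdet h3 h1

end CoordGroupInvariant

lemma tripleEquiv_of_conjugate {k : Type*} [Field k] [IsAlgClosed k] (h2 : (2 : k) ≠ 0)
    {I J : Finset k} (hI : ∀ a ∈ I, a ≠ 2 ∧ a ≠ -2) (hJ : ∀ a ∈ J, a ≠ 2 ∧ a ≠ -2)
    {φ : Kxy k ≃ₐ[k] Kxy k}
    (h : Subgroup.map (MulAut.conj φ).toMonoidHom (GI k I) = GI k J) : TripleEquiv I J := by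
  rw [GI_eq_coordGroup, GI_eq_coordGroup, coordGroup_map] at h
  exact ((isCoord_Xv k).map φ).tripleEquiv_of_coordGroup_eq h2 hI hJ (isCoord_Xv k) h

section Backward

open IntermediateField

variable {k K : Type*} [Field k] [Field K] [Algebra k K]

lemma map_fibreProd_eq (σ : K ≃ₐ[k] K) (I : Finset k) {x : K}
    (h : σ (x ^ 2 + (x ^ 2)⁻¹) = x ^ 2 + (x ^ 2)⁻¹) : σ (fibreProd I x) = fibreProd I x := by
  rw [fibreProd, map_prod]
  exact Finset.prod_congr rfl fun a _ => by rw [map_sub, h, AlgEquiv.commutes]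

lemma coordGroup_eq_of_mul_eq {I J : Finset k} {x y u w : K} (h : IsCoord k x y)
    (h' : IsCoord k u w) (hw : w ^ 2 * fibreProd J x = y ^ 2 * fibreProd I u)
    (ht : ∀ σ : K ≃ₐ[k] K, σ (x ^ 2 + (x ^ 2)⁻¹) = x ^ 2 + (x ^ 2)⁻¹ ↔
      σ (u ^ 2 + (u ^ 2)⁻¹) = u ^ 2 + (u ^ 2)⁻¹) :
    coordGroup k I u w = coordGroup k J x y := by
  have hP := fibreProd_ne_zero J h.transcendental_fst
  have hQ := fibreProd_ne_zero I h'.transcendental_fst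
  have hy := h.snd_ne_zero
  have hw0 := h'.snd_ne_zero
  have hF : fibreProd I u / fibreProd J x ≠ 0 := div_ne_zero hQ hP
  have key : w ^ 2 + fibreProd I u ^ 2 * (w ^ 2)⁻¹ =
      fibreProd I u / fibreProd J x * (y ^ 2 + fibreProd J x ^ 2 * (y ^ 2)⁻¹) := by
    have : w ^ 2 = y ^ 2 * fibreProd I u / fibreProd J x := (eq_div_iff hP).2 hw
    rw [this]
    field_simp
  ext σ
  rw [mem_coordGroup_iff h', mem_coordGroup_iff h, ht]
  refine and_congr_right fun hu => ?_
  rw [key, map_mul, map_div₀, map_fibreProd_eq σ I hu, map_fibreProd_eq σ J ((ht σ).2 hu),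
    mul_right_inj' hF]

/-- Conjugacy of `G_I` and `G_J` in the Cremona group. -/
def Conjugate (I J : Finset k) : Prop :=
  ∃ φ : Kxy k ≃ₐ[k] Kxy k, Subgroup.map (MulAut.conj φ).toMonoidHom (GI k I) = GI k J

lemma Conjugate.refl (I : Finset k) : Conjugate I I := by
  refine ⟨1, ?_⟩
  ext σ
  simp

lemma Conjugate.trans {I J L : Finset k} (h : Conjugate I J) (h' : Conjugate J L) :
    Conjugate I L := by
  obtain ⟨φ, hφ⟩ := h
  obtain ⟨ψ, hψ⟩ := h'
  refine ⟨ψ * φ, ?_⟩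
  rw [← hψ, ← hφ, Subgroup.map_map, map_mul]
  rfl

variable [IsAlgClosed k]

lemma conjugate_of_fibreProd_eq {I J : Finset k} {u s : Kxy k} {e : k} (he : e ≠ 0)
    (hxu : Xv k 0 ∈ k⟮u⟯) (hs : s ∈ k⟮Xv k 0⟯) (hs0 : s ≠ 0)
    (h : s ^ 2 * fibreProd I u = algebraMap k _ e * fibreProd J (Xv k 0))
    (ht : ∀ σ : Kxy k ≃ₐ[k] Kxy k,
      σ (Xv k 0 ^ 2 + (Xv k 0 ^ 2)⁻¹) = Xv k 0 ^ 2 + (Xv k 0 ^ 2)⁻¹ ↔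
      σ (u ^ 2 + (u ^ 2)⁻¹) = u ^ 2 + (u ^ 2)⁻¹) : Conjugate I J := by
  obtain ⟨c, hc⟩ := IsAlgClosed.exists_pow_nat_eq e two_pos
  have hc0 : algebraMap k (Kxy k) c ≠ 0 := by
    rw [_root_.map_ne_zero]
    rintro rfl
    exact he (by simp [← hc])
  have hxy := isCoord_Xv k
  have huw : IsCoord k u (algebraMap k _ c / s * Xv k 1) := by
    have hx : Xv k 0 ∈ adjoin k {u, algebraMap k _ c / s * Xv k 1} :=
      adjoin.mono k _ _ (by simp) hxu
    have hs' : s ∈ adjoin k {u, algebraMap k _ c / s * Xv k 1} :=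
      adjoin_simple_le_iff.2 hx hs
    refine hxy.of_mem hx ?_
    have hw : algebraMap k _ c / s * Xv k 1 ∈ adjoin k {u, algebraMap k _ c / s * Xv k 1} :=
      subset_adjoin k _ (by simp)
    have hy := mul_mem (div_mem hs' (IntermediateField.algebraMap_mem _ c)) hw
    rwa [← mul_assoc, div_mul_div_cancel₀ hc0, div_self hs0, one_mul] at hy
  obtain ⟨φ, hφ, hφ'⟩ := hxy.exists_algEquiv huw
  refine ⟨φ, ?_⟩
  rw [GI_eq_coordGroup, GI_eq_coordGroup, coordGroup_map, hφ, hφ']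
  refine coordGroup_eq_of_mul_eq hxy huw ?_ ht
  rw [mul_pow, div_pow, ← map_pow, hc]
  field_simp
  linear_combination -h

lemma conjugate_image_neg (I : Finset k) : Conjugate I (I.image fun a => -a) := by
  obtain ⟨i, hi⟩ := IsAlgClosed.exists_pow_nat_eq (-1 : k) two_pos
  have hi0 : algebraMap k (Kxy k) i ≠ 0 := by
    rw [_root_.map_ne_zero]
    rintro rfl
    simp at hi
  have ht : (algebraMap k _ i * Xv k 0) ^ 2 + ((algebraMap k _ i * Xv k 0) ^ 2)⁻¹ =
      -(Xv k 0 ^ 2 + (Xv k 0 ^ 2)⁻¹) := by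
    rw [mul_pow, ← map_pow, hi, map_neg, map_one, neg_one_mul, inv_neg]
    ring
  refine conjugate_of_fibreProd_eq (u := algebraMap k _ i * Xv k 0) (s := 1) (e := (-1) ^ I.card)
    (pow_ne_zero _ (by simp)) ?_ (one_mem _) one_ne_zero ?_ ?_
  · have hd := div_mem (mem_adjoin_simple_self k (algebraMap k (Kxy k) i * Xv k 0))
      (IntermediateField.algebraMap_mem _ i)
    rwa [mul_div_cancel_left₀ _ hi0] at hd
  · rw [fibreProd, fibreProd, Finset.prod_image (fun a _ b _ => neg_inj.1), one_pow, one_mul,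
      map_pow, map_neg, map_one, ← Finset.prod_const, ← Finset.prod_mul_distrib]
    refine Finset.prod_congr rfl fun a _ => ?_
    rw [ht, map_neg]
    ring
  · intro σ
    rw [ht, map_neg, neg_inj]

lemma conjugate_image_homography (h2 : (2 : k) ≠ 0) {I : Finset k} (hI : ∀ a ∈ I, a ≠ 2) :
    Conjugate I (I.image fun a => (2 * a + 12) / (a - 2)) := by
  have hx := (isCoord_Xv k).transcendental_fst
  have hx0 := hx.ne_zero'
  have hne : ∀ c : k, Xv k 0 - algebraMap k _ c ≠ 0 := fun c =>
    sub_ne_zero.2 (hx.ne_algebraMap c)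
  have hx1 : Xv k 0 - 1 ≠ 0 := by simpa using hne 1
  have hx2 : Xv k 0 + 1 ≠ 0 := by simpa using hne (-1)
  have h2K : (2 : Kxy k) ≠ 0 := by
    rw [← map_ofNat (algebraMap k (Kxy k))]
    exact (_root_.map_ne_zero _).2 h2
  generalize hX : Xv k 0 = x at *
  set u := (x + 1) / (x - 1) with hu
  have hu1 : u - 1 ≠ 0 := by
    have : u - 1 = 2 / (x - 1) := by rw [hu]; field_simp; ring
    rw [this]
    exact div_ne_zero h2K hx1
  have hxu : x = (u + 1) / (u - 1) := by
    rw [eq_div_iff hu1, hu]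
    field_simp
    ring
  have hs : (x - x⁻¹) ^ 2 = x ^ 2 + (x ^ 2)⁻¹ - 2 := by field_simp; ring
  have hs0 : x - x⁻¹ ≠ 0 := by
    have : x - x⁻¹ = (x - 1) * (x + 1) / x := by field_simp; ring
    rw [this]
    exact div_ne_zero (mul_ne_zero hx1 hx2) hx0
  have ht : (u ^ 2 + (u ^ 2)⁻¹) * (x ^ 2 + (x ^ 2)⁻¹ - 2) = 2 * (x ^ 2 + (x ^ 2)⁻¹) + 12 := by
    rw [hu, ← hs]
    field_simp
    ring
  have hT : x ^ 2 + (x ^ 2)⁻¹ - 2 ≠ 0 := hs ▸ pow_ne_zero 2 hs0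
  have hU : u ^ 2 + (u ^ 2)⁻¹ - 2 ≠ 0 := by
    intro h0
    have : (16 : Kxy k) = 0 := by linear_combination (x ^ 2 + (x ^ 2)⁻¹ - 2) * h0 - ht
    have h16 : (16 : Kxy k) = 2 ^ 4 := by norm_num
    exact pow_ne_zero 4 h2K (h16 ▸ this)
  refine conjugate_of_fibreProd_eq (u := u) (s := (x - x⁻¹) ^ I.card)
    (e := ∏ a ∈ I, (2 - a)) (Finset.prod_ne_zero_iff.2 fun a ha => sub_ne_zero.2 (hI a ha).symm)
    ?_ ?_ (pow_ne_zero _ hs0) ?_ ?_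
  · rw [hX, hxu]
    exact div_mem (add_mem (mem_adjoin_simple_self k _) (one_mem _))
      (sub_mem (mem_adjoin_simple_self k _) (one_mem _))
  · rw [hX]
    exact pow_mem (sub_mem (mem_adjoin_simple_self k _) (inv_mem (mem_adjoin_simple_self k _))) _
  · rw [hX, fibreProd, fibreProd, Finset.prod_image, map_prod, ← pow_mul, mul_comm I.card, pow_mul,
      hs, ← Finset.prod_const, ← Finset.prod_mul_distrib, ← Finset.prod_mul_distrib]
    · refine Finset.prod_congr rfl fun a ha => ?_
      have ha2 : algebraMap k (Kxy k) a - 2 ≠ 0 := by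
        rw [← map_ofNat (algebraMap k (Kxy k)), ← map_sub, _root_.map_ne_zero]
        exact sub_ne_zero.2 (hI a ha)
      rw [map_div₀, map_sub, map_sub, map_add, map_mul, map_ofNat, map_ofNat]
      field_simp at ht ⊢
      linear_combination (algebraMap k (Kxy k) a - 2) * ht
    · intro a ha b hb hab
      have ha2 := sub_ne_zero.2 (hI a ha)
      have hb2 := sub_ne_zero.2 (hI b hb)
      simp only [div_eq_div_iff ha2 hb2] at hab
      have : (2 : k) ^ 4 * (a - b) = 0 := by linear_combination -hab
      exact sub_eq_zero.1 ((mul_eq_zero.1 this).resolve_left (pow_ne_zero 4 h2))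
  · intro σ
    rw [hX]
    have hσ := congrArg σ ht
    rw [map_mul, map_sub, map_add σ (2 * _), map_mul, map_ofNat, map_ofNat] at hσ
    constructor
    · intro h
      rw [h] at hσ
      exact mul_right_cancel₀ hT (hσ.trans ht.symm)
    · intro h
      rw [h] at hσ
      exact mul_right_cancel₀ hU (by linear_combination hσ - ht)

lemma conjugate_image_mul (I : Finset k) {ε : k} (hε : ε = 1 ∨ ε = -1) :
    Conjugate I (I.image fun a => ε * a) := by
  rcases hε with rfl | rfl
  · simpa using Conjugate.refl I
  · simpa using conjugate_image_neg I

omit [IsAlgClosed k] in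
lemma eq_image_of_moebius {I J : Finset k} {a b c d : k} {f : k → k}
    (h : moebius k a b c d '' pts I = pts J) (hf : ∀ i ∈ I, moebius k a b c d i = f i) :
    J = I.image f := by
  have : pts (I.image f) = pts J := by
    rw [← h]
    ext z
    constructor
    · rintro ⟨j, hj, rfl⟩
      obtain ⟨i, hi, rfl⟩ := Finset.mem_image.1 hj
      exact ⟨i, ⟨i, hi, rfl⟩, hf i hi⟩
    · rintro ⟨_, ⟨i, hi, rfl⟩, rfl⟩
      exact ⟨f i, Finset.mem_image_of_mem f hi, (hf i hi).symm⟩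
  exact (Finset.coe_injective (OnePoint.coe_injective.image_injective this)).symm

omit [IsAlgClosed k] in
/-- The homographies preserving `{2, -2, ∞}`. -/
lemma exists_normal_form (h2 : (2 : k) ≠ 0) {a b c d : k} (hdet : a * d - b * c ≠ 0)
    (hT : moebius k a b c d '' triple k = triple k) :
    (∃ ε : k, (ε = 1 ∨ ε = -1) ∧ ∀ z : k, moebius k a b c d z = (ε * z : k)) ∨
    ∃ ε δ : k, (ε = 1 ∨ ε = -1) ∧ (δ = 1 ∨ δ = -1) ∧ ∀ z : k, δ * z ≠ 2 →
      moebius k a b c d z = (ε * ((2 * (δ * z) + 12) / (δ * z - 2)) : k) := by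
  have hmem : ∀ z ∈ triple k, moebius k a b c d z ∈ triple k := fun z hz =>
    hT ▸ Set.mem_image_of_mem _ hz
  have h4 : (4 : k) ≠ 0 := by
    rw [show (4 : k) = 2 * 2 by norm_num]
    exact mul_ne_zero h2 h2
  by_cases hc : c = 0
  · subst hc
    have hd : d ≠ 0 := by rintro rfl; simp at hdet
    have ha : a ≠ 0 := by rintro rfl; simp at hdet
    have e1 := hmem (2 : k) (by simp)
    have e2 := hmem (-2 : k) (by simp)
    simp only [moebius_coe, zero_mul, zero_add, hd, if_false, Set.mem_insert_iff,
      Set.mem_singleton_iff, OnePoint.coe_ne_infty, or_false, OnePoint.coe_eq_coe,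
      div_eq_iff hd] at e1 e2
    have hne : a * 2 + b ≠ a * -2 + b := fun h => mul_ne_zero h4 ha (by linear_combination h)
    have hb : b = 0 := by
      refine (mul_eq_zero.1 (?_ : 2 * b = 0)).resolve_left h2
      rcases e1 with e1 | e1 <;> rcases e2 with e2 | e2
      · exact absurd (e1.trans e2.symm) hne
      · linear_combination e1 + e2
      · linear_combination e1 + e2
      · exact absurd (e1.trans e2.symm) hne
    subst hb
    have had : a = d ∨ a = -d := by
      refine e1.imp (fun e => mul_left_cancel₀ h2 ?_) fun e => mul_left_cancel₀ h2 ?_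
      · linear_combination e
      · linear_combination e
    refine .inl ⟨a / d, had.imp (fun h => by rw [h, div_self hd])
      (fun h => by rw [h, neg_div, div_self hd]), fun z => ?_⟩
    rw [moebius_coe, zero_mul, zero_add, if_neg hd, add_zero, div_mul_eq_mul_div]
  · obtain ⟨ε, hε, ha⟩ : ∃ ε : k, (ε = 1 ∨ ε = -1) ∧ a = 2 * ε * c := by
      have := hmem ∞ (by simp)
      simp only [moebius_infty, hc, if_false, Set.mem_insert_iff, Set.mem_singleton_iff,
        OnePoint.coe_ne_infty, or_false, OnePoint.coe_eq_coe, div_eq_iff hc] at this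
      rcases this with h | h
      · exact ⟨1, .inl rfl, by rw [h]; ring⟩
      · exact ⟨-1, .inr rfl, by rw [h]; ring⟩
    obtain ⟨δ, hδ, hd⟩ : ∃ δ : k, (δ = 1 ∨ δ = -1) ∧ d = -(2 * δ * c) := by
      obtain ⟨z, hz, h⟩ : (∞ : OnePoint k) ∈ moebius k a b c d '' triple k := by
        rw [hT]
        simp
      rcases hz with rfl | rfl | rfl
      · exact ⟨1, .inl rfl, by simp at h; linear_combination h⟩
      · exact ⟨-1, .inr rfl, by simp at h; linear_combination h⟩
      · simp [hc] at h
    have hε2 : ε ^ 2 = 1 := by rcases hε with rfl | rfl <;> norm_num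
    have hδ2 : δ ^ 2 = 1 := by rcases hδ with rfl | rfl <;> norm_num
    have hδ0 : δ ≠ 0 := by rintro rfl; simp at hδ2
    have hb : b = 12 * ε * δ * c := by
      have hden : c * (-2 * δ) + d ≠ 0 := by
        rw [hd]
        exact fun h => mul_ne_zero (mul_ne_zero h4 hδ0) hc (by linear_combination -h)
      have := hmem (-2 * δ : k) (by rcases hδ with rfl | rfl <;> simp)
      simp only [moebius_coe, hden, if_false, Set.mem_insert_iff, Set.mem_singleton_iff,
        OnePoint.coe_ne_infty, or_false, OnePoint.coe_eq_coe, div_eq_iff hden] at this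
      have key : a * (-2 * δ) + b = 2 * ε * (c * (-2 * δ) + d) ∨
          a * (-2 * δ) + b = -2 * ε * (c * (-2 * δ) + d) := by
        rcases hε with rfl | rfl
        · simpa using this
        · simpa using this.symm
      rcases key with h | h
      · refine absurd ?_ hdet
        rw [ha, hd] at h ⊢
        linear_combination -c * h
      · rw [ha, hd] at h
        linear_combination h
    refine .inr ⟨ε, δ, hε, hδ, fun z hz => ?_⟩
    have hz' : δ * z - 2 ≠ 0 := sub_ne_zero.2 hz
    have hden : c * z + d ≠ 0 := by
      rw [hd]
      refine fun h => mul_ne_zero hc hz' ?_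
      linear_combination δ * h + 2 * c * hδ2
    rw [moebius_coe, if_neg hden, mul_div_assoc', OnePoint.coe_eq_coe, div_eq_div_iff hden hz', ha,
      hb, hd]
    linear_combination (16 * ε * c * z) * hδ2

lemma TripleEquiv.conjugate (h2 : (2 : k) ≠ 0) {I J : Finset k}
    (hI : ∀ a ∈ I, a ≠ 2 ∧ a ≠ -2) (h : TripleEquiv I J) : Conjugate I J := by
  obtain ⟨a, b, c, d, hdet, hT, hIJ⟩ := h
  rcases exists_normal_form h2 hdet hT with ⟨ε, hε, h⟩ | ⟨ε, δ, hε, hδ, h⟩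
  · rw [eq_image_of_moebius hIJ fun i _ => h i]
    exact conjugate_image_mul I hε
  · have hδI : ∀ i ∈ I, δ * i ≠ 2 := by
      intro i hi
      rcases hδ with rfl | rfl
      · simpa using (hI i hi).1
      · simpa [neg_eq_iff_eq_neg] using (hI i hi).2
    rw [eq_image_of_moebius hIJ fun i hi => h i (hδI i hi)]
    refine (conjugate_image_mul I hδ).trans ?_
    have h1 := conjugate_image_homography h2 (I := I.image fun a => δ * a) (by simpa using hδI)
    have h3 := h1.trans (conjugate_image_mul _ hε)
    rwa [Finset.image_image, Finset.image_image] at h3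

end Backward

/-- `k` algebraically closed with `char k ≠ 2`.  For finite subsets
`I, J ⊆ k ∖ {2,-2}`, the subgroups `G_I` and `G_J` are conjugate in the Cremona group
`Aut_k(k(x,y))` if and only if `J = γ(I)` for some homography `γ` of `ℙ¹(k)` preserving
`{2, -2, ∞}`. -/
theorem GI_conjugate_iff_S3_equivalent
    (k : Type*) [Field k] [IsAlgClosed k] (hchar : ringChar k ≠ 2)
    (I J : Finset k) (hI : ∀ a ∈ I, a ≠ 2 ∧ a ≠ -2) (hJ : ∀ a ∈ J, a ≠ 2 ∧ a ≠ -2) :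
    (∃ φ : Kxy k ≃ₐ[k] Kxy k,
        Subgroup.map (MulAut.conj φ).toMonoidHom (GI k I) = GI k J) ↔
    (∃ a b c d : k, a * d - b * c ≠ 0 ∧
      moebius k a b c d ''
          {((2 : k) : OnePoint k), ((-2 : k) : OnePoint k), (∞ : OnePoint k)} =
        {((2 : k) : OnePoint k), ((-2 : k) : OnePoint k), (∞ : OnePoint k)} ∧
      moebius k a b c d '' ((fun x : k => (x : OnePoint k)) '' (I : Set k)) =
        (fun x : k => (x : OnePoint k)) '' (J : Set k)) := by
  have h2 : (2 : k) ≠ 0 := Ring.two_ne_zero hchar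
  exact ⟨fun ⟨_, h⟩ => tripleEquiv_of_conjugate h2 hI hJ h, TripleEquiv.conjugate h2 hI⟩
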